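/- arXiv:0903.1359 — 2 statements merged into one kernel-verified Lean document; each statement's English description precedes it below -/
import Mathlib

section
/- Let p be a prime, m ≥ 1, and suppose n = p^m − 1 is coprime to 3. Let k = 2 and A = {0,1,3} ⊆ ℤ_n. Then h_2(X_A;𝔽_p), the dimension over 𝔽_p of the space of 𝔽_p-linear combinations of facets of X_A with vanishing boundary, equals (n−1)/6 if p = 2, equals (n−2)/6 if p = 3, and equals (n−4)/6 if p > 3. -/
open scoped BigOperators

/-- The facets of the sum complex `X_A`. -/
def sumComplexFacets (n k : ℕ) [NeZero n] (A : Finset (ZMod n)) :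
    Finset (Finset (ZMod n)) :=
  Finset.univ.filter (fun σ => σ.card = k + 1 ∧ (∑ x ∈ σ, x) ∈ A)

/-- Coefficient of `τ` in the simplicial boundary of `σ`, ordering the elements of `σ`
by their representatives in `{0, …, n-1}`: it is `(-1)^i` if `τ = σ \ {x}` where `x`
is the `i`-th smallest element of `σ`, and `0` otherwise. -/
noncomputable def bdryCoeff (n : ℕ) [NeZero n] (F : Type*) [Field F]
    (σ τ : Finset (ZMod n)) : F :=
  ∑ x ∈ σ, if τ = σ.erase x then
    (-1 : F) ^ ((σ.filter (fun y => y.val < x.val)).card) else 0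

/-- The simplicial boundary operator `∂` on the chain space of `ℤ_n`
(the free `F`-vector space on the finite subsets of `ℤ_n`). -/
noncomputable def bdry (n : ℕ) [NeZero n] (F : Type*) [Field F] :
    (Finset (ZMod n) → F) →ₗ[F] (Finset (ZMod n) → F) where
  toFun c := fun τ => ∑ σ : Finset (ZMod n), c σ * bdryCoeff n F σ τ
  map_add' c d := by
    funext τ
    simp [add_mul, Finset.sum_add_distrib]
  map_smul' r c := by
    funext τ
    simp [Finset.mul_sum, mul_assoc]

/-- The basis vector of the chain space corresponding to a finite subset `σ ⊆ ℤ_n`. -/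
noncomputable def ind (n : ℕ) [NeZero n] (F : Type*) [Field F] (σ : Finset (ZMod n)) :
    Finset (ZMod n) → F :=
  fun τ => if τ = σ then 1 else 0

/-- `h_k(X_A; F)`: the dimension of the kernel of the restriction of the boundary
operator `∂` to the span of the facets of the sum complex `X_A`. -/
noncomputable def hTop (n : ℕ) [NeZero n] (F : Type*) [Field F] (k : ℕ)
    (A : Finset (ZMod n)) : ℕ :=
  Module.finrank F (LinearMap.ker ((bdry n F).domRestrict
    (Submodule.span F (ind n F '' ↑(sumComplexFacets n k A)))))

/-- A function of three variables is alternating. -/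
structure IsAlt {X M : Type*} [AddCommGroup M] (f : X → X → X → M) : Prop where
  diag : ∀ x z, f x x z = 0
  swap₁ : ∀ x y z, f y x z = -f x y z
  swap₂ : ∀ x y z, f x z y = -f x y z

namespace IsAlt

variable {X Y M : Type*} [AddCommGroup M]

lemma diag₂ {f : X → X → X → M} (hf : IsAlt f) (x y : X) : f x y y = 0 := by
  rw [← neg_eq_zero, ← hf.swap₁, ← neg_eq_zero, ← hf.swap₂, hf.diag]

lemma diag₃ {f : X → X → X → M} (hf : IsAlt f) (x y : X) : f x y x = 0 := by
  rw [← neg_eq_zero, ← hf.swap₂, hf.diag]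

lemma rotate {f : X → X → X → M} (hf : IsAlt f) (x y z : X) : f y z x = f x y z := by
  rw [hf.swap₂ y x z, hf.swap₁ x y z, neg_neg]

lemma rotate' {f : X → X → X → M} (hf : IsAlt f) (x y z : X) : f z x y = f x y z := by
  rw [hf.swap₁ x z y, hf.swap₂ x y z, neg_neg]

lemma reverse {f : X → X → X → M} (hf : IsAlt f) (x y z : X) : f z y x = -f x y z := by
  rw [hf.swap₁ y z x, hf.rotate]

lemma mul_symm {R : Type*} [CommRing R] {f s : X → X → X → R} (hf : IsAlt f)
    (h₁ : ∀ x y z, s y x z = s x y z) (h₂ : ∀ x y z, s x z y = s x y z) :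
    IsAlt fun x y z => s x y z * f x y z where
  diag x z := by simp [hf.diag]
  swap₁ x y z := by rw [h₁ x y, hf.swap₁ x y, mul_neg]
  swap₂ x y z := by rw [h₂ x y, hf.swap₂ x y, mul_neg]

lemma sum_sum_eq_zero [Fintype X] {g : X → X → M} (hd : ∀ x, g x x = 0)
    (hs : ∀ x y, g y x = -g x y) : ∑ x, ∑ y, g x y = 0 := by
  classical
  rw [← Fintype.sum_prod_type']
  refine Finset.sum_involution (fun a _ => (a.2, a.1)) ?_ ?_ ?_ ?_
  · rintro ⟨x, y⟩ -
    simp [hs x y]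
  · rintro ⟨x, y⟩ - h he
    simp only [Prod.mk.injEq] at he
    exact h (by simp [he.1, hd])
  · simp
  · simp

/-- Integral transforms with a product kernel preserve alternation. -/
lemma transform {R : Type*} [CommRing R] [Fintype X] {f : X → X → X → R} (hf : IsAlt f)
    (k : Y → X → R) :
    IsAlt fun y₁ y₂ y₃ => ∑ x₁, ∑ x₂, ∑ x₃, f x₁ x₂ x₃ * (k y₁ x₁ * k y₂ x₂ * k y₃ x₃) where
  diag y z := by
    refine sum_sum_eq_zero (fun x => by simp [hf.diag]) fun x₁ x₂ => ?_
    rw [← Finset.sum_neg_distrib]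
    exact Finset.sum_congr rfl fun x₃ _ => by rw [hf.swap₁ x₁ x₂]; ring
  swap₁ y₁ y₂ y₃ := by
    rw [Finset.sum_comm]
    simp only [← Finset.sum_neg_distrib]
    refine Finset.sum_congr rfl fun x₁ _ => Finset.sum_congr rfl fun x₂ _ =>
      Finset.sum_congr rfl fun x₃ _ => ?_
    rw [hf.swap₁ x₁ x₂]; ring
  swap₂ y₁ y₂ y₃ := by
    simp only [← Finset.sum_neg_distrib]
    refine Finset.sum_congr rfl fun x₁ _ => ?_
    rw [Finset.sum_comm]
    refine Finset.sum_congr rfl fun x₂ _ => Finset.sum_congr rfl fun x₃ _ => ?_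
    rw [hf.swap₂ x₁ x₂]; ring

end IsAlt

/-- The sign of the permutation sorting `x, y, z` by increasing `v`, or `0` if two of the values
coincide. -/
def orderSign {X : Type*} (v : X → ℕ) (x y z : X) : ℤ :=
  Int.sign ((v y : ℤ) - v x) * Int.sign ((v z : ℤ) - v y) * Int.sign ((v z : ℤ) - v x)

lemma isAlt_orderSign {X : Type*} (v : X → ℕ) : IsAlt (orderSign v) where
  diag x z := by simp [orderSign]
  swap₁ x y z := by
    rw [orderSign, orderSign, ← neg_sub (v y : ℤ) (v x), Int.sign_neg]; ring
  swap₂ x y z := by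
    rw [orderSign, orderSign, ← neg_sub (v z : ℤ) (v y), Int.sign_neg]; ring

lemma isAlt_orderSign_smul {X M : Type*} [DecidableEq X] [AddCommGroup M] (v : X → ℕ)
    (c : Finset X → M) : IsAlt fun x y z => orderSign v x y z • c {x, y, z} where
  diag x z := by simp [(isAlt_orderSign v).diag]
  swap₁ x y z := by
    rw [(isAlt_orderSign v).swap₁ x y, Finset.insert_comm, neg_smul]
  swap₂ x y z := by
    rw [(isAlt_orderSign v).swap₂ x y, Finset.pair_comm, neg_smul]

lemma orderSign_mul_self {X : Type*} {v : X → ℕ} (hv : v.Injective) {x y z : X}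
    (hxy : x ≠ y) (hxz : x ≠ z) (hyz : y ≠ z) :
    orderSign v x y z * orderSign v x y z = 1 := by
  have key : ∀ a b : X, a ≠ b →
      Int.sign ((v b : ℤ) - v a) * Int.sign ((v b : ℤ) - v a) = 1 := by
    intro a b hab
    have : v a ≠ v b := fun h => hab (hv h)
    rcases lt_or_gt_of_ne this with h | h
    · rw [Int.sign_eq_one_of_pos (by omega)]; rfl
    · rw [Int.sign_eq_neg_one_of_neg (by omega)]; rfl
  calc _ = (Int.sign ((v y : ℤ) - v x) * Int.sign ((v y : ℤ) - v x)) *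
        (Int.sign ((v z : ℤ) - v y) * Int.sign ((v z : ℤ) - v y)) *
        (Int.sign ((v z : ℤ) - v x) * Int.sign ((v z : ℤ) - v x)) := by
          rw [orderSign]; ring
    _ = 1 := by rw [key _ _ hxy, key _ _ hyz, key _ _ hxz]; rfl

lemma orderSign_smul_eq_zero {X M : Type*} [AddCommGroup M] {v : X → ℕ} (hv : v.Injective)
    {x y z : X} (hxy : x ≠ y) (hxz : x ≠ z) (hyz : y ≠ z) {c : M}
    (h : orderSign v x y z • c = 0) : c = 0 := by
  rw [← one_smul ℤ c, ← orderSign_mul_self hv hxy hxz hyz, mul_smul, h, smul_zero]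

lemma triple_cases {X : Type*} [DecidableEq X] {x y z a b c : X} (hxy : x ≠ y) (hxz : x ≠ z)
    (hyz : y ≠ z) (h : ({x, y, z} : Finset X) = {a, b, c}) :
    (x = a ∧ y = b ∧ z = c) ∨ (x = a ∧ y = c ∧ z = b) ∨ (x = b ∧ y = a ∧ z = c) ∨
    (x = b ∧ y = c ∧ z = a) ∨ (x = c ∧ y = a ∧ z = b) ∨ (x = c ∧ y = b ∧ z = a) := by
  have hx : x ∈ ({a, b, c} : Finset X) := h ▸ by simp
  have hy : y ∈ ({a, b, c} : Finset X) := h ▸ by simp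
  have hz : z ∈ ({a, b, c} : Finset X) := h ▸ by simp
  simp only [Finset.mem_insert, Finset.mem_singleton] at hx hy hz
  grind

/-- Every alternating function comes from a function on three-element subsets. -/
lemma IsAlt.exists_lift {X M : Type*} [DecidableEq X] [AddCommGroup M] {v : X → ℕ}
    (hv : v.Injective) {f : X → X → X → M} (hf : IsAlt f) :
    ∃ c : Finset X → M, (∀ σ, σ.card ≠ 3 → c σ = 0) ∧
      ∀ x y z, f x y z = orderSign v x y z • c {x, y, z} := by
  have key : ∀ σ : Finset X, ∃ m : M, (σ.card ≠ 3 → m = 0) ∧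
      ∀ x y z, {x, y, z} = σ → f x y z = orderSign v x y z • m := by
    intro σ
    have hg := isAlt_orderSign v
    by_cases hσ : σ.card = 3
    · obtain ⟨a, b, c, hab, hac, hbc, rfl⟩ := Finset.card_eq_three.1 hσ
      refine ⟨orderSign v a b c • f a b c, fun h => absurd hσ h, fun x y z hxyz => ?_⟩
      have hs : orderSign v a b c • orderSign v a b c • f a b c = f a b c := by
        rw [smul_smul, orderSign_mul_self hv hab hac hbc, one_smul]
      rcases triple_cases hab hac hbc hxyz.symm with ⟨rfl, rfl, rfl⟩ | ⟨rfl, rfl, rfl⟩ |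
        ⟨rfl, rfl, rfl⟩ | ⟨rfl, rfl, rfl⟩ | ⟨rfl, rfl, rfl⟩ | ⟨rfl, rfl, rfl⟩
      · exact hs.symm
      · rw [hg.swap₂ a b c, hf.swap₂ a b c, neg_smul, hs]
      · rw [hg.swap₁ a b c, hf.swap₁ a b c, neg_smul, hs]
      · rw [hg.rotate' a b c, hf.rotate' a b c, hs]
      · rw [hg.rotate a b c, hf.rotate a b c, hs]
      · rw [hg.reverse a b c, hf.reverse a b c, neg_smul, hs]
    · refine ⟨0, fun _ => rfl, fun x y z hxyz => ?_⟩
      rw [smul_zero]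
      by_contra hne
      refine hσ (Finset.card_eq_three.2 ⟨x, y, z, ?_, ?_, ?_, hxyz.symm⟩)
      · rintro rfl; exact hne (hf.diag _ _)
      · rintro rfl; exact hne (hf.diag₃ _ _)
      · rintro rfl; exact hne (hf.diag₂ _ _)
  choose c hc₁ hc₂ using key
  exact ⟨c, hc₁, fun x y z => hc₂ _ x y z rfl⟩

/-- The alternating functions on `ℤ_n³` supported on the triples with sum in `A` whose sums along
the last coordinate vanish; these are the `2`-cycles of the sum complex with coefficients in `M`. -/
def altCycles (n : ℕ) [NeZero n] (A : Finset (ZMod n)) (R M : Type*) [Ring R] [AddCommGroup M]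
    [Module R M] : Submodule R (ZMod n → ZMod n → ZMod n → M) where
  carrier := {f | IsAlt f ∧ (∀ x y z, x + y + z ∉ A → f x y z = 0) ∧ ∀ x y, ∑ z, f x y z = 0}
  zero_mem' := ⟨⟨by simp, by simp, by simp⟩, by simp, by simp⟩
  add_mem' := by
    rintro f g ⟨hf, hf', hf''⟩ ⟨hg, hg', hg''⟩
    refine ⟨⟨fun x z => ?_, fun x y z => ?_, fun x y z => ?_⟩, fun x y z h => ?_, fun x y => ?_⟩
    · simp [hf.diag, hg.diag]
    · simp only [Pi.add_apply]
      rw [hf.swap₁ x y, hg.swap₁ x y, neg_add]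
    · simp only [Pi.add_apply]
      rw [hf.swap₂ x y, hg.swap₂ x y, neg_add]
    · simp [hf' x y z h, hg' x y z h]
    · simp [Finset.sum_add_distrib, hf'', hg'']
  smul_mem' := by
    rintro r f ⟨hf, hf', hf''⟩
    refine ⟨⟨fun x z => ?_, fun x y z => ?_, fun x y z => ?_⟩, fun x y z h => ?_, fun x y => ?_⟩
    · simp [hf.diag]
    · simp only [Pi.smul_apply]
      rw [hf.swap₁ x y, smul_neg]
    · simp only [Pi.smul_apply]
      rw [hf.swap₂ x y, smul_neg]
    · simp [hf' x y z h]
    · simp [← Finset.smul_sum, hf'']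

lemma mem_altCycles {n : ℕ} [NeZero n] {A : Finset (ZMod n)} {R M : Type*} [Ring R]
    [AddCommGroup M] [Module R M] {f : ZMod n → ZMod n → ZMod n → M} :
    f ∈ altCycles n A R M ↔
      IsAlt f ∧ (∀ x y z, x + y + z ∉ A → f x y z = 0) ∧ ∀ x y, ∑ z, f x y z = 0 :=
  Iff.rfl

section Boundary

variable {n : ℕ} [NeZero n] {F : Type*} [Field F]

lemma bdry_apply (c : Finset (ZMod n) → F) (τ : Finset (ZMod n)) :
    bdry n F c τ = ∑ w, if w ∈ τ then 0 else
      c (insert w τ) * (-1) ^ (τ.filter fun y => y.val < w.val).card := by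
  have h : ∀ σ, c σ * bdryCoeff n F σ τ = ∑ w, if w ∉ τ ∧ σ = insert w τ then
      c σ * (-1) ^ (τ.filter fun y => y.val < w.val).card else 0 := by
    intro σ
    rw [bdryCoeff, Finset.mul_sum, ← Finset.sum_subset (Finset.subset_univ σ)]
    · refine Finset.sum_congr rfl fun w hw => ?_
      by_cases hτ : τ = σ.erase w
      · have h1 : w ∉ τ ∧ σ = insert w τ := by
          subst hτ
          simp [Finset.insert_erase hw]
        rw [if_pos hτ, if_pos h1, h1.2, Finset.filter_insert, if_neg (lt_irrefl _)]
      · rw [if_neg hτ, mul_zero, if_neg]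
        rintro ⟨h1, rfl⟩
        exact hτ (Finset.erase_insert h1).symm
    · intro w _ hw
      rw [if_neg]
      rintro ⟨-, rfl⟩
      exact hw (Finset.mem_insert_self _ _)
  change ∑ σ, c σ * bdryCoeff n F σ τ = _
  simp only [h]
  rw [Finset.sum_comm]
  refine Finset.sum_congr rfl fun w _ => ?_
  by_cases hw : w ∈ τ <;> simp [hw]

lemma sum_orderSign_smul {x y : ZMod n} (hxy : x.val < y.val) (c : Finset (ZMod n) → F) :
    ∑ z, orderSign ZMod.val x y z • c {x, y, z} = bdry n F c {x, y} := by
  rw [bdry_apply]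
  refine Finset.sum_congr rfl fun z _ => ?_
  have hne : x ≠ y := by rintro rfl; exact lt_irrefl _ hxy
  by_cases hzx : z = x
  · subst hzx; simp [(isAlt_orderSign _).diag₃]
  by_cases hzy : z = y
  · subst hzy; simp [(isAlt_orderSign _).diag₂]
  rw [if_neg (by simp [hzx, hzy]), show ({x, y, z} : Finset (ZMod n)) = insert z {x, y} by
    ext; simp; tauto, zsmul_eq_mul, mul_comm]
  congr 1
  have h1 : z.val ≠ x.val := fun h => hzx (ZMod.val_injective n h)
  have h2 : z.val ≠ y.val := fun h => hzy (ZMod.val_injective n h)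
  rw [orderSign, Int.sign_eq_one_of_pos (by omega), Finset.filter_insert, Finset.filter_singleton]
  rcases lt_or_gt_of_ne h1 with h1 | h1
  · rw [if_neg (by omega), if_neg (by omega), Int.sign_eq_neg_one_of_neg (by omega),
      Int.sign_eq_neg_one_of_neg (by omega)]
    simp
  · rw [if_pos h1, Int.sign_eq_one_of_pos (a := (z.val : ℤ) - x.val) (by omega)]
    rcases lt_or_gt_of_ne h2 with h2 | h2
    · rw [if_neg (by omega), Int.sign_eq_neg_one_of_neg (by omega)]
      simp
    · rw [if_pos h2, Int.sign_eq_one_of_pos (by omega), Finset.card_insert_of_notMem (by simpa)]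
      simp

lemma mem_span_ind {S : Finset (Finset (ZMod n))} {c : Finset (ZMod n) → F} :
    c ∈ Submodule.span F (ind n F '' ↑S) ↔ ∀ σ, σ ∉ S → c σ = 0 := by
  constructor
  · intro hc σ hσ
    induction hc using Submodule.span_induction with
    | mem x hx =>
      obtain ⟨τ, hτ, rfl⟩ := hx
      rw [ind, if_neg]
      rintro rfl
      exact hσ hτ
    | zero => rfl
    | add x y _ _ hx hy => simp [hx, hy]
    | smul a x _ hx => simp [hx]
  · intro hc
    have : c = ∑ τ ∈ S, c τ • ind n F τ := by
      funext σ
      simp only [Finset.sum_apply, Pi.smul_apply, ind, smul_eq_mul, mul_ite, mul_one, mul_zero]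
      rw [Finset.sum_ite_eq]
      split_ifs with h
      · rfl
      · exact hc σ h
    rw [this]
    exact Submodule.sum_mem _ fun τ hτ =>
      Submodule.smul_mem _ _ (Submodule.subset_span ⟨τ, hτ, rfl⟩)

lemma bdry_eq_zero_of_card_ne {c : Finset (ZMod n) → F} (hc : ∀ σ, σ.card ≠ 3 → c σ = 0)
    {τ : Finset (ZMod n)} (hτ : τ.card ≠ 2) : bdry n F c τ = 0 := by
  rw [bdry_apply]
  refine Finset.sum_eq_zero fun w _ => ?_
  split_ifs with hw
  · rfl
  · rw [hc, zero_mul]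
    rw [Finset.card_insert_of_notMem hw]
    omega

/-- The alternating function of a chain. -/
def altOfChain (n : ℕ) [NeZero n] (F : Type*) [Field F] :
    (Finset (ZMod n) → F) →ₗ[F] (ZMod n → ZMod n → ZMod n → F) where
  toFun c x y z := orderSign ZMod.val x y z • c {x, y, z}
  map_add' c d := by funext x y z; simp
  map_smul' r c := by funext x y z; simp [mul_left_comm]

lemma altOfChain_apply (c : Finset (ZMod n) → F) (x y z : ZMod n) :
    altOfChain n F c x y z = orderSign ZMod.val x y z • c {x, y, z} := rfl

lemma altOfChain_mem_altCycles_iff {A : Finset (ZMod n)} {c : Finset (ZMod n) → F}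
    (hc : ∀ σ, σ.card ≠ 3 → c σ = 0) :
    altOfChain n F c ∈ altCycles n A F F ↔
      (∀ σ, σ ∉ sumComplexFacets n 2 A → c σ = 0) ∧ bdry n F c = 0 := by
  have hinj := ZMod.val_injective n
  rw [mem_altCycles]
  constructor
  · rintro ⟨-, h1, h2⟩
    refine ⟨fun σ hσ => ?_, ?_⟩
    · by_cases h3 : σ.card = 3
      · obtain ⟨x, y, z, hxy, hxz, hyz, rfl⟩ := Finset.card_eq_three.1 h3
        refine orderSign_smul_eq_zero hinj hxy hxz hyz (h1 x y z fun hA => hσ ?_)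
        simp only [sumComplexFacets, Finset.mem_filter, Finset.mem_univ, true_and]
        refine ⟨h3, ?_⟩
        rwa [Finset.sum_insert (by simp [hxy, hxz]), Finset.sum_pair hyz, ← add_assoc]
      · exact hc σ h3
    · funext τ
      by_cases hτ : τ.card = 2
      · obtain ⟨x, y, hxy, rfl⟩ := Finset.card_eq_two.1 hτ
        rcases lt_or_gt_of_ne (hinj.ne hxy) with h | h
        · rw [← sum_orderSign_smul h]
          exact h2 x y
        · rw [Finset.pair_comm, ← sum_orderSign_smul h]
          exact h2 y x
      · exact bdry_eq_zero_of_card_ne hc hτ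
  · rintro ⟨h1, h2⟩
    have halt : IsAlt (altOfChain n F c) := isAlt_orderSign_smul _ _
    refine ⟨halt, fun x y z hA => ?_, fun x y => ?_⟩
    · by_cases h3 : ({x, y, z} : Finset (ZMod n)) ∈ sumComplexFacets n 2 A
      · simp only [sumComplexFacets, Finset.mem_filter, Finset.mem_univ, true_and] at h3
        have hxy : x ≠ y := by
          rintro rfl
          have := Finset.card_le_two (a := x) (b := z)
          simp at h3; omega
        have hxz : x ≠ z := by
          rintro rfl
          have := Finset.card_le_two (a := x) (b := y)
          rw [Finset.pair_comm] at h3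
          simp at h3; omega
        have hyz : y ≠ z := by
          rintro rfl
          have := Finset.card_le_two (a := x) (b := y)
          simp at h3; omega
        rw [Finset.sum_insert (by simp [hxy, hxz]), Finset.sum_pair hyz, ← add_assoc] at h3
        exact absurd h3.2 hA
      · rw [altOfChain_apply, h1 _ h3, smul_zero]
    · rcases lt_trichotomy x.val y.val with h | h | h
      · exact (sum_orderSign_smul h c).trans (congrFun h2 _)
      · obtain rfl := hinj h
        exact Finset.sum_eq_zero fun z _ => halt.diag x z
      · rw [Finset.sum_congr rfl fun z _ => halt.swap₁ y x z, Finset.sum_neg_distrib]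
        simp only [altOfChain_apply]
        rw [sum_orderSign_smul h c, h2, Pi.zero_apply, neg_zero]

lemma hTop_two_eq_finrank_altCycles (A : Finset (ZMod n)) :
    hTop n F 2 A = Module.finrank F (altCycles n A F F) := by
  set V := Submodule.span F (ind n F '' ↑(sumComplexFacets n 2 A))
  set N := LinearMap.ker ((bdry n F).domRestrict V)
  have hV : ∀ c ∈ V, ∀ σ : Finset (ZMod n), σ.card ≠ 3 → c σ = 0 := fun c hc σ hσ =>
    mem_span_ind.1 hc σ fun h => hσ (Finset.mem_filter.1 h).2.1
  have hN : ∀ c : N, altOfChain n F c.1.1 ∈ altCycles n A F F := fun c =>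
    (altOfChain_mem_altCycles_iff (hV _ c.1.2)).2 ⟨mem_span_ind.1 c.1.2, c.2⟩
  let Θ : N →ₗ[F] altCycles n A F F :=
    ((altOfChain n F).comp (V.subtype.comp N.subtype)).codRestrict _ hN
  refine (LinearEquiv.ofBijective Θ ⟨?_, ?_⟩).finrank_eq
  · intro c d hcd
    ext σ
    by_cases h3 : σ.card = 3
    · obtain ⟨x, y, z, hxy, hxz, hyz, rfl⟩ := Finset.card_eq_three.1 h3
      refine sub_eq_zero.1 (orderSign_smul_eq_zero (ZMod.val_injective n) hxy hxz hyz ?_)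
      rw [smul_sub, sub_eq_zero]
      exact congrFun (congrFun (congrFun (congrArg Subtype.val hcd) x) y) z
    · rw [hV _ c.1.2 _ h3, hV _ d.1.2 _ h3]
  · rintro ⟨f, hf⟩
    obtain ⟨c, hc, hfc⟩ := (mem_altCycles.1 hf).1.exists_lift (ZMod.val_injective n)
    have hfc' : altOfChain n F c = f := by
      funext x y z; exact (hfc x y z).symm
    obtain ⟨h1, h2⟩ := (altOfChain_mem_altCycles_iff hc).1 (hfc' ▸ hf)
    exact ⟨⟨⟨c, mem_span_ind.2 h1⟩, h2⟩, Subtype.ext hfc'⟩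

end Boundary

section BaseChange

variable {n : ℕ} [NeZero n] {A : Finset (ZMod n)}

lemma comp_mem_altCycles {R M N : Type*} [Ring R] [AddCommGroup M] [AddCommGroup N] [Module R M]
    [Module R N] (φ : M →ₗ[R] N) {f : ZMod n → ZMod n → ZMod n → M}
    (hf : f ∈ altCycles n A R M) : (fun x y z => φ (f x y z)) ∈ altCycles n A R N := by
  obtain ⟨hf, hf', hf''⟩ := hf
  refine ⟨⟨fun x z => ?_, fun x y z => ?_, fun x y z => ?_⟩, fun x y z h => ?_, fun x y => ?_⟩
  · simp [hf.diag]
  · rw [hf.swap₁ x y, map_neg]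
  · rw [hf.swap₂ x y, map_neg]
  · simp [hf' x y z h]
  · rw [← map_sum, hf'', map_zero]

/-- Cycles with coefficients in a free module are families of cycles with scalar coefficients. -/
noncomputable def altCyclesBasisEquiv {F M ι : Type*} [Field F] [AddCommGroup M] [Module F M]
    [Fintype ι] (b : Module.Basis ι F M) : altCycles n A F M ≃ₗ[F] (ι → altCycles n A F F) where
  toFun f i := ⟨_, comp_mem_altCycles (b.coord i) f.2⟩
  invFun g := ∑ i, ⟨_, comp_mem_altCycles (LinearMap.toSpanSingleton F M (b i)) (g i).2⟩
  map_add' f g := by ext; simp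
  map_smul' r f := by ext; simp
  left_inv f := by
    ext x y z
    simp [Finset.sum_apply, b.sum_repr]
  right_inv g := by
    ext i x y z
    classical
    simp [Finset.sum_apply, Finsupp.single_apply]

lemma finrank_altCycles_baseChange (F K : Type*) [Field F] [Field K] [Algebra F K]
    [FiniteDimensional F K] :
    Module.finrank F (altCycles n A F F) = Module.finrank K (altCycles n A K K) := by
  have h1 : Module.finrank F (altCycles n A F K) =
      Module.finrank F K * Module.finrank F (altCycles n A F F) := by
    rw [(altCyclesBasisEquiv (Module.finBasis F K)).finrank_eq, Module.finrank_pi_fintype]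
    simp
  have h2 : Module.finrank F K * Module.finrank K (altCycles n A K K) =
      Module.finrank F (altCycles n A K K) := Module.finrank_mul_finrank F K _
  have e : altCycles n A F K ≃ₗ[F] altCycles n A K K :=
    { toFun := fun f => ⟨f.1, f.2⟩
      invFun := fun f => ⟨f.1, f.2⟩
      map_add' := fun _ _ => rfl
      map_smul' := fun _ _ => rfl
      left_inv := fun _ => rfl
      right_inv := fun _ => rfl }
  rw [← e.finrank_eq, h1] at h2
  exact (Nat.eq_of_mul_eq_mul_left Module.finrank_pos h2).symm

end BaseChange

section Characters

variable {n : ℕ} {K : Type*} [Field K]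

/-- The power `t ^ x` of a unit `t`, as an element of the field, for an exponent `x` modulo `n`. -/
def unitPow (t : Kˣ) (x : ZMod n) : K := (t : K) ^ x.val

lemma unitPow_mul (s t : Kˣ) (x : ZMod n) : unitPow (s * t) x = unitPow s x * unitPow t x := by
  simp [unitPow, mul_pow]

lemma unitPow_inv (t : Kˣ) (x : ZMod n) : unitPow t⁻¹ x = (unitPow t x)⁻¹ := by
  simp [unitPow]

lemma unitPow_ne_zero (t : Kˣ) (x : ZMod n) : unitPow t x ≠ 0 := by
  simp [unitPow]

@[simp] lemma unitPow_zero (t : Kˣ) : unitPow t (0 : ZMod n) = 1 := by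
  simp [unitPow]

@[simp] lemma unitPow_one_left (x : ZMod n) : unitPow (1 : Kˣ) x = 1 := by
  simp [unitPow]

lemma unitPow_one_right (hn : 2 ≤ n) (t : Kˣ) : unitPow t (1 : ZMod n) = t := by
  have : Fact (1 < n) := ⟨hn⟩
  rw [unitPow, ZMod.val_one, pow_one]

lemma unitPow_three (hn : 4 ≤ n) (t : Kˣ) : unitPow t (3 : ZMod n) = (t : K) ^ 3 := by
  rw [unitPow, show (3 : ZMod n) = ((3 : ℕ) : ZMod n) by rfl, ZMod.val_natCast,
    Nat.mod_eq_of_lt hn]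

variable [Fintype K]

lemma card_cast_eq_neg_one (hK : Fintype.card K = n + 1) : (n : K) = -1 := by
  have := FiniteField.cast_card_eq_zero K
  rw [hK, Nat.cast_add, Nat.cast_one] at this
  exact eq_neg_of_add_eq_zero_left this

lemma units_pow_three_injective (hK : Fintype.card K = n + 1) (hcop : n.Coprime 3) :
    Function.Injective fun t : Kˣ => t ^ 3 := by
  classical
  have h : (Nat.card Kˣ).Coprime 3 := by
    rwa [Nat.card_eq_fintype_card, Fintype.card_units, hK, Nat.add_sub_cancel]
  exact (powCoprime h).injective

variable [NeZero n]

lemma unitPow_add (hK : Fintype.card K = n + 1) (t : Kˣ) (x y : ZMod n) :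
    unitPow t (x + y) = unitPow t x * unitPow t y := by
  have ht : (t : K) ^ n = 1 := by
    have := FiniteField.pow_card_sub_one_eq_one (t : K) t.ne_zero
    rwa [hK, Nat.add_sub_cancel] at this
  rw [unitPow, unitPow, unitPow, ZMod.val_add, ← pow_eq_pow_mod _ ht, pow_add]

lemma unitPow_neg (hK : Fintype.card K = n + 1) (t : Kˣ) (x : ZMod n) :
    unitPow t (-x) = (unitPow t x)⁻¹ := by
  refine eq_inv_of_mul_eq_one_left ?_
  rw [← unitPow_add hK, neg_add_cancel, unitPow_zero]

variable [DecidableEq K]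

lemma sum_unitPow_left (hK : Fintype.card K = n + 1) (x : ZMod n) :
    ∑ t : Kˣ, unitPow t x = if x = 0 then -1 else 0 := by
  have h := FiniteField.sum_pow_units K x.val
  rw [hK, Nat.add_sub_cancel] at h
  refine h.trans ?_
  congr 1
  rw [← CharP.cast_eq_zero_iff (ZMod n) n, ZMod.natCast_zmod_val]

lemma sum_unitPow_right (hK : Fintype.card K = n + 1) (hn : 2 ≤ n) (t : Kˣ) :
    ∑ x : ZMod n, unitPow t x = if t = 1 then -1 else 0 := by
  split_ifs with h
  · subst h
    simp [ZMod.card, card_cast_eq_neg_one hK]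
  · have h1 : (t : K) * ∑ x : ZMod n, unitPow t x = ∑ x : ZMod n, unitPow t x := by
      rw [Finset.mul_sum, ← Equiv.sum_comp (Equiv.addLeft (1 : ZMod n)) fun x => unitPow t x]
      refine Finset.sum_congr rfl fun x _ => ?_
      rw [Equiv.coe_addLeft, unitPow_add hK, unitPow_one_right hn]
    by_contra h2
    exact h (Units.ext (by simpa using (mul_eq_right₀ h2).1 h1))

/-- The monomial attached to a triple of units and a triple of exponents. -/
def triplePow (t₁ t₂ t₃ : Kˣ) (x y z : ZMod n) : K := unitPow t₁ x * unitPow t₂ y * unitPow t₃ z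

lemma sum_triplePow_units (hK : Fintype.card K = n + 1) (hcop : n.Coprime 3) {x y z : ZMod n}
    (h : x + y + z = 0) :
    ∑ t₁ : Kˣ, ∑ t₂ : Kˣ, ∑ t₃ : Kˣ, (if t₁ * t₂ * t₃ = 1 then triplePow t₁ t₂ t₃ x y z else 0) =
      if x = 0 ∧ y = 0 then 1 else 0 := by
  have hz : z = -(x + y) := (neg_eq_of_add_eq_zero_right h).symm
  let φ : Kˣ × Kˣ → Kˣ × Kˣ := fun t => (t.1 ^ 2 * t.2, t.1 * t.2 ^ 2)
  have hφ : Function.Bijective φ := by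
    refine Finite.injective_iff_bijective.1 ?_
    rintro ⟨a, b⟩ ⟨c, d⟩ hab
    simp only [φ, Prod.mk.injEq] at hab
    have hc := units_pow_three_injective hK hcop
    have e1 : ∀ a b : Kˣ, a ^ 3 = (a ^ 2 * b) ^ 2 / (a * b ^ 2) := fun a b => by
      rw [eq_div_iff_mul_eq']
      simp only [pow_succ, pow_zero, one_mul]
      simp only [mul_comm, mul_left_comm]
    have hac : a = c := hc (by simp only [e1 a b, e1 c d, hab.1, hab.2])
    subst hac
    exact Prod.ext rfl (mul_left_cancel hab.1)
  have h1 : ∀ t₁ t₂ : Kˣ, ∑ t₃ : Kˣ,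
      (if t₁ * t₂ * t₃ = 1 then triplePow t₁ t₂ t₃ x y z else 0) =
        unitPow (φ (t₁, t₂)).1 x * unitPow (φ (t₁, t₂)).2 y := by
    intro t₁ t₂
    simp only [mul_eq_one_iff_inv_eq, Finset.sum_ite_eq, Finset.mem_univ, if_true]
    simp only [triplePow, φ, hz, unitPow_neg hK, unitPow_add hK, unitPow_inv, unitPow_mul,
      pow_two]
    field_simp
  simp only [h1]
  rw [← Fintype.sum_prod_type' (f := fun t₁ t₂ => unitPow (φ (t₁, t₂)).1 x *
    unitPow (φ (t₁, t₂)).2 y), hφ.sum_comp fun t => unitPow t.1 x * unitPow t.2 y,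
    Fintype.sum_prod_type]
  simp only [← Finset.mul_sum, ← Finset.sum_mul, sum_unitPow_left hK]
  split_ifs <;> simp_all

lemma sum_triplePow_zmod (hK : Fintype.card K = n + 1) (hn : 2 ≤ n) (hcop : n.Coprime 3)
    {t₁ t₂ t₃ : Kˣ} (h : t₁ * t₂ * t₃ = 1) (a : ZMod n) :
    ∑ x, ∑ y, ∑ z, (if x + y + z = a then triplePow t₁ t₂ t₃ x y z else 0) =
      if t₁ = 1 ∧ t₂ = 1 then 1 else 0 := by
  have h1 : ∀ x y : ZMod n, ∑ z, (if x + y + z = a then triplePow t₁ t₂ t₃ x y z else 0) =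
      unitPow (t₁ * t₃⁻¹) x * unitPow (t₂ * t₃⁻¹) y * unitPow t₃ a := by
    intro x y
    have : ∀ z, x + y + z = a ↔ a - (x + y) = z := fun z => by
      rw [sub_eq_iff_eq_add', eq_comm]
    simp only [this, Finset.sum_ite_eq, Finset.mem_univ, if_true]
    simp only [triplePow, sub_eq_add_neg, unitPow_add hK, unitPow_neg hK, unitPow_mul, unitPow_inv]
    ring
  simp only [h1, ← Finset.mul_sum, ← Finset.sum_mul, sum_unitPow_right hK hn, mul_inv_eq_one]
  by_cases h2 : t₁ = 1 ∧ t₂ = 1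
  · obtain ⟨rfl, rfl⟩ := h2
    obtain rfl : t₃ = 1 := by simpa using h
    simp
  · rw [if_neg h2]
    by_cases h3 : t₁ = t₃
    · by_cases h4 : t₂ = t₃
      · subst h3 h4
        have : t₂ = 1 := units_pow_three_injective hK hcop (by simpa [pow_succ] using h)
        exact absurd ⟨this, this⟩ h2
      · simp [h4]
    · simp [h3]

end Characters

lemma sum_comm_triple {X Y M : Type*} [Fintype X] [Fintype Y] [AddCommMonoid M]
    (g : X → X → X → Y → Y → Y → M) :
    ∑ x₁, ∑ x₂, ∑ x₃, ∑ y₁, ∑ y₂, ∑ y₃, g x₁ x₂ x₃ y₁ y₂ y₃ =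
      ∑ y₁, ∑ y₂, ∑ y₃, ∑ x₁, ∑ x₂, ∑ x₃, g x₁ x₂ x₃ y₁ y₂ y₃ := by
  have := Finset.sum_comm (s := (Finset.univ : Finset (X × X × X)))
    (t := (Finset.univ : Finset (Y × Y × Y)))
    (f := fun x y => g x.1 x.2.1 x.2.2 y.1 y.2.1 y.2.2)
  simpa only [Fintype.sum_prod_type] using this

lemma vandermonde_zero_one_three {K : Type*} [Field K] {t₁ t₂ t₃ g₀ g₁ g₃ : K}
    (h12 : t₁ ≠ t₂) (h13 : t₁ ≠ t₃) (h23 : t₂ ≠ t₃) (e₁ : g₀ + g₁ * t₁ + g₃ * t₁ ^ 3 = 0)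
    (e₂ : g₀ + g₁ * t₂ + g₃ * t₂ ^ 3 = 0) (e₃ : g₀ + g₁ * t₃ + g₃ * t₃ ^ 3 = 0)
    (hp : t₁ * t₂ * t₃ = 1) :
    g₃ * (t₁ + t₂ + t₃) = 0 ∧ g₁ = (t₁ * t₂ + t₁ * t₃ + t₂ * t₃) * g₃ ∧ g₀ = -g₃ := by
  have E12 : g₁ + g₃ * (t₁ ^ 2 + t₁ * t₂ + t₂ ^ 2) = 0 :=
    mul_left_cancel₀ (sub_ne_zero.2 h12) (by linear_combination e₁ - e₂)
  have E13 : g₁ + g₃ * (t₁ ^ 2 + t₁ * t₃ + t₃ ^ 2) = 0 :=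
    mul_left_cancel₀ (sub_ne_zero.2 h13) (by linear_combination e₁ - e₃)
  have S : g₃ * (t₁ + t₂ + t₃) = 0 :=
    mul_left_cancel₀ (sub_ne_zero.2 h23) (by linear_combination E12 - E13)
  have G : g₁ = (t₁ * t₂ + t₁ * t₃ + t₂ * t₃) * g₃ := by
    linear_combination E12 - (t₁ + t₂) * S
  exact ⟨S, G, by linear_combination e₁ - t₁ * G - t₁ ^ 2 * S - g₃ * hp⟩

section Fourier

variable {n : ℕ} {K : Type*} [Field K]

/-- The Fourier transform of the restriction of `f` to the triples with sum `a`. -/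
def sliceFourier [NeZero n] (f : ZMod n → ZMod n → ZMod n → K) (a : ZMod n) (t₁ t₂ t₃ : Kˣ) : K :=
  ∑ x, ∑ y, ∑ z, ((if x + y + z = a then 1 else 0) * f x y z) *
    (unitPow t₁ (-x) * unitPow t₂ (-y) * unitPow t₃ (-z))

lemma isAlt_sliceFourier [NeZero n] {f : ZMod n → ZMod n → ZMod n → K} (hf : IsAlt f)
    (a : ZMod n) : IsAlt (sliceFourier f a) :=
  (hf.mul_symm (s := fun x y z => if x + y + z = a then 1 else 0)
    (fun x y z => by rw [add_comm y x])
    (fun x y z => by rw [add_right_comm x z y])).transform fun t x => unitPow t (-x)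

variable [NeZero n] [Fintype K] [DecidableEq K]

lemma sum_sliceFourier_mul_triplePow (hK : Fintype.card K = n + 1) (hcop : n.Coprime 3)
    (f : ZMod n → ZMod n → ZMod n → K) (x y z : ZMod n) :
    ∑ t₁ : Kˣ, ∑ t₂ : Kˣ, ∑ t₃ : Kˣ, (if t₁ * t₂ * t₃ = 1 then
      sliceFourier f (x + y + z) t₁ t₂ t₃ else 0) * triplePow t₁ t₂ t₃ x y z = f x y z := by
  have h1 : ∀ t₁ t₂ t₃ : Kˣ, (if t₁ * t₂ * t₃ = 1 then
      sliceFourier f (x + y + z) t₁ t₂ t₃ else 0) * triplePow t₁ t₂ t₃ x y z =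
      ∑ x', ∑ y', ∑ z', ((if x' + y' + z' = x + y + z then 1 else 0) * f x' y' z') *
        (if t₁ * t₂ * t₃ = 1 then triplePow t₁ t₂ t₃ (x - x') (y - y') (z - z') else 0) := by
    intro t₁ t₂ t₃
    split_ifs with h
    · simp only [sliceFourier, Finset.sum_mul]
      refine Finset.sum_congr rfl fun x' _ => Finset.sum_congr rfl fun y' _ =>
        Finset.sum_congr rfl fun z' _ => ?_
      simp only [triplePow, sub_eq_add_neg, unitPow_add hK]
      ring
    · simp
  simp only [h1]
  rw [sum_comm_triple]
  simp only [← Finset.mul_sum]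
  have h2 : ∀ x' y' z' : ZMod n, ((if x' + y' + z' = x + y + z then 1 else 0) * f x' y' z') *
      (∑ t₁ : Kˣ, ∑ t₂ : Kˣ, ∑ t₃ : Kˣ, if t₁ * t₂ * t₃ = 1 then
        triplePow t₁ t₂ t₃ (x - x') (y - y') (z - z') else 0) =
      if x' = x then if y' = y then if z' = z then f x y z else 0 else 0 else 0 := by
    intro x' y' z'
    by_cases h : x' + y' + z' = x + y + z
    · rw [sum_triplePow_units hK hcop (by linear_combination -h), if_pos h]
      simp only [sub_eq_zero, @eq_comm _ x, @eq_comm _ y]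
      by_cases hx : x' = x
      · by_cases hy : y' = y
        · subst hx hy
          obtain rfl := add_left_cancel h
          simp
        · simp [hy]
      · simp [hx]
    · rw [if_neg h, zero_mul, zero_mul]
      split_ifs with hx hy hz
      · exact absurd (by rw [hx, hy, hz]) h
      all_goals rfl
  simp only [h2, Finset.sum_ite_eq', Finset.mem_univ, if_true, Finset.sum_ite_irrel,
    Finset.sum_const_zero]

lemma sliceFourier_sum_mul_triplePow (hK : Fintype.card K = n + 1) (hn : 2 ≤ n)
    (hcop : n.Coprime 3) (C : ZMod n → Kˣ → Kˣ → Kˣ → K)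
    (hC : ∀ a t₁ t₂ t₃, t₁ * t₂ * t₃ ≠ 1 → C a t₁ t₂ t₃ = 0) (a : ZMod n) {s₁ s₂ s₃ : Kˣ}
    (hs : s₁ * s₂ * s₃ = 1) :
    sliceFourier (fun x y z => ∑ t₁ : Kˣ, ∑ t₂ : Kˣ, ∑ t₃ : Kˣ,
      C (x + y + z) t₁ t₂ t₃ * triplePow t₁ t₂ t₃ x y z) a s₁ s₂ s₃ = C a s₁ s₂ s₃ := by
  have h1 : ∀ x y z : ZMod n, ((if x + y + z = a then 1 else 0) *
      ∑ t₁ : Kˣ, ∑ t₂ : Kˣ, ∑ t₃ : Kˣ,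
        C (x + y + z) t₁ t₂ t₃ * triplePow t₁ t₂ t₃ x y z) *
      (unitPow s₁ (-x) * unitPow s₂ (-y) * unitPow s₃ (-z)) =
      ∑ t₁ : Kˣ, ∑ t₂ : Kˣ, ∑ t₃ : Kˣ, C a t₁ t₂ t₃ * (if x + y + z = a then
        triplePow (t₁ * s₁⁻¹) (t₂ * s₂⁻¹) (t₃ * s₃⁻¹) x y z else 0) := by
    intro x y z
    split_ifs with h
    · simp only [h, one_mul, Finset.sum_mul]
      refine Finset.sum_congr rfl fun t₁ _ => Finset.sum_congr rfl fun t₂ _ =>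
        Finset.sum_congr rfl fun t₃ _ => ?_
      simp only [triplePow, unitPow_mul, unitPow_inv, unitPow_neg hK]
      ring
    · simp
  simp only [sliceFourier, h1]
  rw [sum_comm_triple]
  simp only [← Finset.mul_sum]
  have h2 : ∀ t₁ t₂ t₃ : Kˣ, C a t₁ t₂ t₃ * ∑ x, ∑ y, ∑ z, (if x + y + z = a then
        triplePow (t₁ * s₁⁻¹) (t₂ * s₂⁻¹) (t₃ * s₃⁻¹) x y z else 0) =
      if t₁ = s₁ then if t₂ = s₂ then if t₃ = s₃ then C a s₁ s₂ s₃ else 0 else 0 else 0 := by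
    intro t₁ t₂ t₃
    by_cases h : t₁ * t₂ * t₃ = 1
    · rw [sum_triplePow_zmod hK hn hcop (by
        rw [mul_mul_mul_comm t₁, mul_mul_mul_comm (t₁ * t₂), h, ← mul_inv,
          ← mul_inv, hs, inv_one, one_mul])]
      simp only [mul_inv_eq_one]
      by_cases hx : t₁ = s₁
      · by_cases hy : t₂ = s₂
        · subst hx hy
          obtain rfl := mul_left_cancel (h.trans hs.symm)
          simp
        · simp [hy]
      · simp [hx]
    · rw [hC _ _ _ _ h, zero_mul]
      split_ifs with hx hy hz
      · exact absurd (by rw [hx, hy, hz, hs]) h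
      all_goals rfl
  simp only [h2, Finset.sum_ite_eq', Finset.mem_univ, if_true, Finset.sum_ite_irrel,
    Finset.sum_const_zero]

omit [DecidableEq K] in
lemma sum_sliceFourier_mul_unitPow (hK : Fintype.card K = n + 1) {A : Finset (ZMod n)}
    {f : ZMod n → ZMod n → ZMod n → K} (hf : f ∈ altCycles n A K K) (t₁ t₂ t₃ : Kˣ) :
    ∑ a ∈ A, sliceFourier f a t₁ t₂ t₃ * unitPow t₃ a = 0 := by
  simp only [sliceFourier, Finset.sum_mul]
  rw [Finset.sum_comm]
  refine Finset.sum_eq_zero fun x _ => ?_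
  rw [Finset.sum_comm]
  refine Finset.sum_eq_zero fun y _ => ?_
  rw [Finset.sum_comm]
  have h : ∀ z, ∑ a ∈ A, (if x + y + z = a then 1 else 0) * f x y z *
      (unitPow t₁ (-x) * unitPow t₂ (-y) * unitPow t₃ (-z)) * unitPow t₃ a =
      unitPow t₁ (-x) * unitPow t₂ (-y) * unitPow t₃ (x + y) * f x y z := by
    intro z
    by_cases hz : x + y + z ∈ A
    · rw [Finset.sum_eq_single_of_mem _ hz]
      · rw [if_pos rfl, unitPow_add hK _ (x + y) z, unitPow_neg hK t₃]
        field_simp [unitPow_ne_zero]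
      · intro a _ ha
        rw [if_neg ha.symm]
        ring
    · rw [hf.2.1 x y z hz]
      simp
  simp only [h, ← Finset.mul_sum, hf.2.2, mul_zero]

omit [Fintype K] [DecidableEq K] in
lemma sliceFourier_eq_zero {A : Finset (ZMod n)} {f : ZMod n → ZMod n → ZMod n → K}
    (hf : f ∈ altCycles n A K K) {a : ZMod n} (ha : a ∉ A) (t₁ t₂ t₃ : Kˣ) :
    sliceFourier f a t₁ t₂ t₃ = 0 := by
  refine Finset.sum_eq_zero fun x _ => Finset.sum_eq_zero fun y _ =>
    Finset.sum_eq_zero fun z _ => ?_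
  split_ifs with h
  · rw [hf.2.1 x y z (h ▸ ha)]
    ring
  · ring

end Fourier

section Cubics

variable {n : ℕ} [NeZero n] {K : Type*} [Field K]

/-- The coefficients of `X ^ 3 + e₂ X - 1`, the cubic with roots `t₁, t₂, t₃` when these have sum
`0` and product `1`. -/
def cubicCoeff [DecidableEq K] (a : ZMod n) (t₁ t₂ t₃ : Kˣ) : K :=
  if a = 3 then 1 else if a = 1 then (t₁ * t₂ + t₁ * t₃ + t₂ * t₃ : K) else if a = 0 then -1 else 0

/-- The three-element sets of units with sum `0` and product `1`. -/
def zeroSumTriples (K : Type*) [Field K] [Fintype K] [DecidableEq K] : Finset (Finset Kˣ) :=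
  Finset.univ.filter fun σ => σ.card = 3 ∧ ∑ t ∈ σ, (t : K) = 0 ∧ ∏ t ∈ σ, t = 1

variable [Fintype K] [DecidableEq K]

lemma mem_zeroSumTriples {t₁ t₂ t₃ : Kˣ} (h12 : t₁ ≠ t₂) (h13 : t₁ ≠ t₃) (h23 : t₂ ≠ t₃) :
    {t₁, t₂, t₃} ∈ zeroSumTriples K ↔ (t₁ + t₂ + t₃ : K) = 0 ∧ t₁ * t₂ * t₃ = 1 := by
  have h1 : t₁ ∉ ({t₂, t₃} : Finset Kˣ) := by simp [h12, h13]
  simp only [zeroSumTriples, Finset.mem_filter, Finset.mem_univ, true_and,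
    Finset.card_eq_three.2 ⟨t₁, t₂, t₃, h12, h13, h23, rfl⟩]
  rw [Finset.sum_insert h1, Finset.sum_pair h23, Finset.prod_insert h1, Finset.prod_pair h23,
    add_assoc, mul_assoc]

section Residues

variable (hn : 4 ≤ n)
include hn

omit [NeZero n] in
lemma natCast_zmod_ne {a b : ℕ} (ha : a < 4) (hb : b < 4) (hab : a ≠ b) : (a : ZMod n) ≠ b := by
  intro h
  have := congrArg ZMod.val h
  rw [ZMod.val_natCast, ZMod.val_natCast, Nat.mod_eq_of_lt (by omega),
    Nat.mod_eq_of_lt (by omega)] at this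
  exact hab this

omit [NeZero n] in
lemma zmod_one_ne_three : (1 : ZMod n) ≠ 3 := by
  simpa using natCast_zmod_ne hn (a := 1) (b := 3) (by norm_num) (by norm_num) (by norm_num)

omit [NeZero n] in
lemma zmod_zero_ne_three : (0 : ZMod n) ≠ 3 := by
  simpa using natCast_zmod_ne hn (a := 0) (b := 3) (by norm_num) (by norm_num) (by norm_num)

omit [NeZero n] in
lemma zmod_zero_ne_one : (0 : ZMod n) ≠ 1 := by
  simpa using natCast_zmod_ne hn (a := 0) (b := 1) (by norm_num) (by norm_num) (by norm_num)

omit [NeZero n] in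
lemma sum_zero_one_three {M : Type*} [AddCommMonoid M] (g : ZMod n → M) :
    ∑ a ∈ ({0, 1, 3} : Finset (ZMod n)), g a = g 0 + g 1 + g 3 := by
  rw [Finset.sum_insert (by simp [zmod_zero_ne_three hn, zmod_zero_ne_one hn]),
    Finset.sum_pair (zmod_one_ne_three hn), add_assoc]

omit [Fintype K] in
lemma sum_cubicCoeff {t₁ t₂ t₃ : Kˣ} (hs : (t₁ + t₂ + t₃ : K) = 0) (hp : t₁ * t₂ * t₃ = 1) :
    ∑ a : ZMod n, cubicCoeff a t₁ t₂ t₃ * unitPow t₃ a = 0 := by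
  rw [← Finset.sum_subset (Finset.subset_univ {0, 1, 3}), sum_zero_one_three hn,
    unitPow_three hn, unitPow_one_right (by omega), unitPow_zero]
  · have hp' : (t₁ * t₂ * t₃ : K) = 1 := by
      rw [← Units.val_mul, ← Units.val_mul, hp, Units.val_one]
    simp only [cubicCoeff, zmod_zero_ne_three hn, zmod_one_ne_three hn, zmod_zero_ne_one hn,
      if_true, if_false]
    linear_combination hp' + (t₃ : K) ^ 2 * hs
  · intro a _ ha
    simp only [Finset.mem_insert, Finset.mem_singleton, not_or] at ha
    simp [cubicCoeff, ha]

lemma sliceFourier_eq_cubicCoeff_mul (hK : Fintype.card K = n + 1)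
    {f : ZMod n → ZMod n → ZMod n → K} (hf : f ∈ altCycles n {0, 1, 3} K K) {t₁ t₂ t₃ : Kˣ}
    (hp : t₁ * t₂ * t₃ = 1) :
    sliceFourier f 3 t₁ t₂ t₃ * (t₁ + t₂ + t₃ : K) = 0 ∧
      ∀ a, sliceFourier f a t₁ t₂ t₃ = cubicCoeff a t₁ t₂ t₃ * sliceFourier f 3 t₁ t₂ t₃ := by
  have halt := fun a => isAlt_sliceFourier hf.1 a
  by_cases h12 : t₁ = t₂
  · subst h12
    simp [(halt _).diag]
  by_cases h13 : t₁ = t₃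
  · subst h13
    simp [(halt _).diag₃]
  by_cases h23 : t₂ = t₃
  · subst h23
    simp [(halt _).diag₂]
  have key := fun s₁ s₂ s₃ : Kˣ => (sum_zero_one_three hn _).symm.trans
    (sum_sliceFourier_mul_unitPow hK hf s₁ s₂ s₃)
  simp only [unitPow_zero, unitPow_three hn, unitPow_one_right (show 2 ≤ n by omega),
    mul_one] at key
  have e₃ := key t₁ t₂ t₃
  have e₂ := key t₁ t₃ t₂
  have e₁ := key t₂ t₃ t₁
  simp only [(halt _).swap₂ t₁ t₂ t₃] at e₂
  simp only [(halt _).rotate t₁ t₂ t₃] at e₁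
  have hp' : (t₁ * t₂ * t₃ : K) = 1 := by
    rw [← Units.val_mul, ← Units.val_mul, hp, Units.val_one]
  obtain ⟨hS, hG₁, hG₀⟩ := vandermonde_zero_one_three (by simpa [Units.ext_iff] using h12)
    (by simpa [Units.ext_iff] using h13) (by simpa [Units.ext_iff] using h23) e₁
    (by linear_combination -e₂) e₃ hp'
  refine ⟨hS, fun a => ?_⟩
  unfold cubicCoeff
  split_ifs with h3 h1 h0
  · rw [h3, one_mul]
  · rw [h1, hG₁]
  · rw [h0, hG₀, neg_one_mul]
  · rw [sliceFourier_eq_zero hf (by simp [h3, h1, h0]), zero_mul]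

end Residues

/-- An injective numbering of the units. -/
noncomputable def unitIndex (K : Type*) [Field K] [Fintype K] [DecidableEq K] (t : Kˣ) : ℕ :=
  Fintype.equivFin Kˣ t

lemma unitIndex_injective : Function.Injective (unitIndex K) :=
  Fin.val_injective.comp (Fintype.equivFin Kˣ).injective

/-- Extension by zero, made alternating, of a function on `zeroSumTriples`. -/
noncomputable def altExtend (c : zeroSumTriples K → K) (t₁ t₂ t₃ : Kˣ) : K :=
  orderSign (unitIndex K) t₁ t₂ t₃ •
    if h : {t₁, t₂, t₃} ∈ zeroSumTriples K then c ⟨_, h⟩ else 0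

lemma isAlt_altExtend (c : zeroSumTriples K → K) : IsAlt (altExtend c) :=
  isAlt_orderSign_smul (unitIndex K)
    fun σ => if h : σ ∈ zeroSumTriples K then c ⟨σ, h⟩ else 0

lemma altExtend_eq_zero (c : zeroSumTriples K → K) {t₁ t₂ t₃ : Kˣ}
    (h : ¬((t₁ + t₂ + t₃ : K) = 0 ∧ t₁ * t₂ * t₃ = 1)) : altExtend c t₁ t₂ t₃ = 0 := by
  have halt := isAlt_altExtend c
  by_cases h12 : t₁ = t₂
  · rw [h12, halt.diag]
  by_cases h13 : t₁ = t₃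
  · rw [h13, halt.diag₃]
  by_cases h23 : t₂ = t₃
  · rw [h23, halt.diag₂]
  rw [altExtend, dif_neg ((mem_zeroSumTriples h12 h13 h23).not.2 h), smul_zero]

/-- The cycle on `ℤ_n³` with prescribed Fourier coefficients on `zeroSumTriples`. -/
noncomputable def cycleOfTriples (n : ℕ) [NeZero n] (K : Type*) [Field K] [Fintype K]
    [DecidableEq K] :
    (zeroSumTriples K → K) →ₗ[K] (ZMod n → ZMod n → ZMod n → K) where
  toFun c x y z := ∑ t₁ : Kˣ, ∑ t₂ : Kˣ, ∑ t₃ : Kˣ,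
    (cubicCoeff (x + y + z) t₁ t₂ t₃ * altExtend c t₁ t₂ t₃) * triplePow t₁ t₂ t₃ x y z
  map_add' c d := by
    funext x y z
    simp only [Pi.add_apply, ← Finset.sum_add_distrib]
    refine Finset.sum_congr rfl fun t₁ _ => Finset.sum_congr rfl fun t₂ _ =>
      Finset.sum_congr rfl fun t₃ _ => ?_
    unfold altExtend
    split_ifs
    · simp; ring
    · simp
  map_smul' r c := by
    funext x y z
    simp only [Pi.smul_apply, Finset.smul_sum, RingHom.id_apply]
    refine Finset.sum_congr rfl fun t₁ _ => Finset.sum_congr rfl fun t₂ _ =>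
      Finset.sum_congr rfl fun t₃ _ => ?_
    unfold altExtend
    split_ifs
    · simp; ring
    · simp

lemma cycleOfTriples_apply (c : zeroSumTriples K → K) (x y z : ZMod n) :
    cycleOfTriples n K c x y z = ∑ t₁ : Kˣ, ∑ t₂ : Kˣ, ∑ t₃ : Kˣ,
      (cubicCoeff (x + y + z) t₁ t₂ t₃ * altExtend c t₁ t₂ t₃) * triplePow t₁ t₂ t₃ x y z :=
  rfl

lemma cycleOfTriples_mem (hK : Fintype.card K = n + 1) (hn : 4 ≤ n) (c : zeroSumTriples K → K) :
    cycleOfTriples n K c ∈ altCycles n {0, 1, 3} K K := by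
  have halt : ∀ a : ZMod n, IsAlt fun x y z => ∑ t₁ : Kˣ, ∑ t₂ : Kˣ, ∑ t₃ : Kˣ,
      (cubicCoeff a t₁ t₂ t₃ * altExtend c t₁ t₂ t₃) *
        (unitPow t₁ x * unitPow t₂ y * unitPow t₃ z) := fun a =>
    ((isAlt_altExtend c).mul_symm (s := cubicCoeff a)
      (fun t₁ t₂ t₃ => by unfold cubicCoeff; split_ifs <;> ring)
      (fun t₁ t₂ t₃ => by unfold cubicCoeff; split_ifs <;> ring)).transform
        fun (x : ZMod n) t => unitPow t x
  refine ⟨⟨fun x z => (halt _).diag x z, fun x y z => ?_, fun x y z => ?_⟩,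
    fun x y z h => ?_, fun x y => ?_⟩
  · rw [cycleOfTriples_apply, add_comm y x]
    exact (halt _).swap₁ x y z
  · rw [cycleOfTriples_apply, add_right_comm x z y]
    exact (halt _).swap₂ x y z
  · simp only [Finset.mem_insert, Finset.mem_singleton, not_or] at h
    simp [cycleOfTriples_apply, cubicCoeff, h]
  · simp only [cycleOfTriples_apply]
    rw [Finset.sum_comm]
    refine Finset.sum_eq_zero fun t₁ _ => ?_
    rw [Finset.sum_comm]
    refine Finset.sum_eq_zero fun t₂ _ => ?_
    rw [Finset.sum_comm]
    refine Finset.sum_eq_zero fun t₃ _ => ?_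
    by_cases h : (t₁ + t₂ + t₃ : K) = 0 ∧ t₁ * t₂ * t₃ = 1
    · have h1 := sum_cubicCoeff hn h.1 h.2
      rw [← Equiv.sum_comp (Equiv.addLeft (x + y))] at h1
      simp only [Equiv.coe_addLeft, unitPow_add hK _ (x + y), mul_left_comm _ (unitPow t₃ (x + y)),
        ← Finset.mul_sum] at h1
      have h2 := (mul_eq_zero.1 h1).resolve_left (unitPow_ne_zero _ _)
      calc _ = ∑ z, altExtend c t₁ t₂ t₃ * unitPow t₁ x * unitPow t₂ y *
            (cubicCoeff (x + y + z) t₁ t₂ t₃ * unitPow t₃ z) :=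
            Finset.sum_congr rfl fun z _ => by unfold triplePow; ring
        _ = 0 := by rw [← Finset.mul_sum, h2, mul_zero]
    · simp [altExtend_eq_zero c h]

lemma sliceFourier_cycleOfTriples (hK : Fintype.card K = n + 1) (hn : 4 ≤ n) (hcop : n.Coprime 3)
    (c : zeroSumTriples K → K) {t₁ t₂ t₃ : Kˣ} (hp : t₁ * t₂ * t₃ = 1) :
    sliceFourier (cycleOfTriples n K c) 3 t₁ t₂ t₃ = altExtend c t₁ t₂ t₃ := by
  refine (sliceFourier_sum_mul_triplePow hK (by omega) hcop
    (fun a t₁ t₂ t₃ => cubicCoeff a t₁ t₂ t₃ * altExtend c t₁ t₂ t₃)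
    (fun a s₁ s₂ s₃ hs => ?_) 3 hp).trans ?_
  · rw [altExtend_eq_zero c fun h => hs h.2, mul_zero]
  · rw [cubicCoeff, if_pos rfl, one_mul]

lemma cycleOfTriples_injective (hK : Fintype.card K = n + 1) (hn : 4 ≤ n) (hcop : n.Coprime 3) :
    Function.Injective (cycleOfTriples n K) := by
  intro c d hcd
  funext ⟨σ, hσ⟩
  obtain ⟨t₁, t₂, t₃, h12, h13, h23, rfl⟩ :=
    Finset.card_eq_three.1 (Finset.mem_filter.1 hσ).2.1
  have hp := ((mem_zeroSumTriples h12 h13 h23).1 hσ).2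
  have h : altExtend c t₁ t₂ t₃ = altExtend d t₁ t₂ t₃ := by
    rw [← sliceFourier_cycleOfTriples hK hn hcop c hp, hcd,
      sliceFourier_cycleOfTriples hK hn hcop d hp]
  rw [altExtend, altExtend, dif_pos hσ, dif_pos hσ] at h
  have h' : orderSign (unitIndex K) t₁ t₂ t₃ • (c ⟨_, hσ⟩ - d ⟨_, hσ⟩) = 0 := by
    rw [smul_sub, h, sub_self]
  exact sub_eq_zero.1 (orderSign_smul_eq_zero unitIndex_injective h12 h13 h23 h')

lemma exists_cycleOfTriples_eq (hK : Fintype.card K = n + 1) (hn : 4 ≤ n) (hcop : n.Coprime 3)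
    {f : ZMod n → ZMod n → ZMod n → K} (hf : f ∈ altCycles n {0, 1, 3} K K) :
    ∃ c, cycleOfTriples n K c = f := by
  have halt : IsAlt fun t₁ t₂ t₃ : Kˣ =>
      (if t₁ * t₂ * t₃ = 1 then 1 else 0) * sliceFourier f 3 t₁ t₂ t₃ :=
    (isAlt_sliceFourier hf.1 3).mul_symm (s := fun t₁ t₂ t₃ => if t₁ * t₂ * t₃ = 1 then 1 else 0)
      (fun t₁ t₂ t₃ => by rw [mul_comm t₂ t₁]) (fun t₁ t₂ t₃ => by rw [mul_right_comm])
  obtain ⟨c, -, hc⟩ := halt.exists_lift unitIndex_injective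
  refine ⟨fun σ => c σ, ?_⟩
  funext x y z
  refine Eq.trans ?_ (sum_sliceFourier_mul_triplePow hK hcop f x y z)
  rw [cycleOfTriples_apply]
  refine Finset.sum_congr rfl fun t₁ _ => Finset.sum_congr rfl fun t₂ _ =>
    Finset.sum_congr rfl fun t₃ _ => ?_
  congr 1
  by_cases hp : t₁ * t₂ * t₃ = 1
  · obtain ⟨hS, hG⟩ := sliceFourier_eq_cubicCoeff_mul hn hK hf hp
    rw [if_pos hp, hG]
    congr 1
    have h := hc t₁ t₂ t₃
    rw [if_pos hp, one_mul] at h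
    by_cases hs : (t₁ + t₂ + t₃ : K) = 0
    · rw [h]
      by_cases hd : t₁ ≠ t₂ ∧ t₁ ≠ t₃ ∧ t₂ ≠ t₃
      · rw [altExtend, dif_pos ((mem_zeroSumTriples hd.1 hd.2.1 hd.2.2).2 ⟨hs, hp⟩)]
      · have h0 : orderSign (unitIndex K) t₁ t₂ t₃ = 0 := by
          have := isAlt_orderSign (unitIndex K)
          by_cases h12 : t₁ = t₂
          · rw [h12, this.diag]
          by_cases h13 : t₁ = t₃
          · rw [h13, this.diag₃]
          by_cases h23 : t₂ = t₃
          · rw [h23, this.diag₂]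
          exact absurd ⟨h12, h13, h23⟩ hd
        rw [altExtend, h0, zero_smul, zero_smul]
    · rw [altExtend_eq_zero _ fun h => hs h.1, (mul_eq_zero.1 hS).resolve_right hs]
  · rw [if_neg hp, altExtend_eq_zero _ fun h => hp h.2, mul_zero]

lemma finrank_altCycles_zero_one_three (hK : Fintype.card K = n + 1) (hn : 4 ≤ n)
    (hcop : n.Coprime 3) :
    Module.finrank K (altCycles n {0, 1, 3} K K) = (zeroSumTriples K).card := by
  have hrange : LinearMap.range (cycleOfTriples n K) = altCycles n {0, 1, 3} K K := by
    ext f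
    refine ⟨?_, fun hf => exists_cycleOfTriples_eq hK hn hcop hf⟩
    rintro ⟨c, rfl⟩
    exact cycleOfTriples_mem hK hn c
  rw [← hrange, LinearMap.finrank_range_of_inj (cycleOfTriples_injective hK hn hcop)]
  simp

end Cubics

section Counting

variable {n : ℕ} {K : Type*} [Field K] [Fintype K] [DecidableEq K]

/-- The ordered triples of distinct units with sum `0` and product `1`. -/
def orderedZeroSumTriples (K : Type*) [Field K] [Fintype K] [DecidableEq K] :
    Finset (Kˣ × Kˣ × Kˣ) :=
  Finset.univ.filter fun t => (t.1 ≠ t.2.1 ∧ t.1 ≠ t.2.2 ∧ t.2.1 ≠ t.2.2) ∧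
    (t.1 + t.2.1 + t.2.2 : K) = 0 ∧ t.1 * t.2.1 * t.2.2 = 1

lemma six_mul_card_zeroSumTriples :
    6 * (zeroSumTriples K).card = (orderedZeroSumTriples K).card := by
  rw [Finset.card_eq_sum_card_fiberwise (s := orderedZeroSumTriples K)
    (f := fun t : Kˣ × Kˣ × Kˣ => ({t.1, t.2.1, t.2.2} : Finset Kˣ)) (t := zeroSumTriples K),
    mul_comm, ← smul_eq_mul, ← Finset.sum_const]
  · refine Finset.sum_congr rfl fun σ hσ => ?_
    obtain ⟨a, b, c, hab, hac, hbc, rfl⟩ := Finset.card_eq_three.1 (Finset.mem_filter.1 hσ).2.1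
    have hm := (mem_zeroSumTriples hab hac hbc).1 hσ
    have : (orderedZeroSumTriples K).filter (fun t => ({t.1, t.2.1, t.2.2} : Finset Kˣ) =
        {a, b, c}) = {(a, b, c), (a, c, b), (b, a, c), (b, c, a), (c, a, b), (c, b, a)} := by
      ext ⟨x, y, z⟩
      simp only [orderedZeroSumTriples, Finset.mem_filter, Finset.mem_univ, true_and,
        Finset.mem_insert, Finset.mem_singleton, Prod.mk.injEq]
      constructor
      · rintro ⟨⟨⟨hxy, hxz, hyz⟩, -⟩, h⟩
        exact triple_cases hxy hxz hyz h
      · intro h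
        have hset : ({x, y, z} : Finset Kˣ) = {a, b, c} := by
          ext w
          simp only [Finset.mem_insert, Finset.mem_singleton]
          grind
        have hd : x ≠ y ∧ x ≠ z ∧ y ≠ z := by grind
        exact ⟨⟨hd, (mem_zeroSumTriples hd.1 hd.2.1 hd.2.2).1 (hset ▸ hσ)⟩, hset⟩
    rw [this]
    simp [Finset.card_insert_of_notMem, hab, hac, hbc, hab.symm, hac.symm, hbc.symm]
  · rintro ⟨x, y, z⟩ ht
    obtain ⟨-, ⟨hxy, hxz, hyz⟩, h⟩ := Finset.mem_filter.1 ht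
    exact (mem_zeroSumTriples hxy hxz hyz).2 h

lemma card_orderedZeroSumTriples (hK : Fintype.card K = n + 1) (hcop : n.Coprime 3) :
    (orderedZeroSumTriples K).card = (Finset.univ.filter fun s : K =>
      s ≠ 0 ∧ s ≠ -1 ∧ s ≠ 1 ∧ s ≠ -2 ∧ 2 * s + 1 ≠ 0).card := by
  have hinj := units_pow_three_injective (K := K) hK hcop
  refine Finset.card_bij (fun t _ => (t.2.1 : K) / t.1) ?_ ?_ ?_
  · rintro ⟨x, y, z⟩ ht
    obtain ⟨-, ⟨hxy, hxz, hyz⟩, hs, -⟩ := Finset.mem_filter.1 ht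
    simp only [ne_eq, Units.ext_iff] at hxy hxz hyz hs ⊢
    have hx := x.ne_zero
    have hz := z.ne_zero
    simp only [Finset.mem_filter, Finset.mem_univ, true_and]
    refine ⟨div_ne_zero y.ne_zero hx, fun h => hz ?_, fun h => hxy ?_, fun h => hxz ?_,
      fun h => hyz ?_⟩
    · rw [div_eq_iff hx] at h
      linear_combination hs - h
    · rw [div_eq_iff hx] at h
      linear_combination -h
    · rw [div_eq_iff hx] at h
      linear_combination h - hs
    · field_simp at h
      linear_combination h - hs
  · rintro ⟨x, y, z⟩ ht ⟨x', y', z'⟩ ht' h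
    obtain ⟨-, -, hs, hp⟩ := Finset.mem_filter.1 ht
    obtain ⟨-, -, hs', hp'⟩ := Finset.mem_filter.1 ht'
    simp only [Units.ext_iff, Units.val_mul, Units.val_one] at hs hp hs' hp' h
    have hx := x.ne_zero
    have hx' := x'.ne_zero
    set s := (y : K) / x with hsdef
    have hy : (y : K) = s * x := (div_eq_iff hx).1 hsdef.symm
    have hy' : (y' : K) = s * x' := (div_eq_iff hx').1 h.symm
    have hz : (z : K) = (-1 - s) * x := by linear_combination hs - hy
    have hz' : (z' : K) = (-1 - s) * x' := by linear_combination hs' - hy'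
    rw [hy, hz] at hp
    rw [hy', hz'] at hp'
    have hne : s * (-1 - s) ≠ 0 := by
      intro h0
      have : (0 : K) = 1 := by linear_combination hp - (x : K) ^ 3 * h0
      exact zero_ne_one this
    have hxx : x = x' := hinj (Units.ext (mul_left_cancel₀ hne (by
      push_cast
      linear_combination hp - hp')))
    subst hxx
    refine Prod.ext rfl (Prod.ext (Units.ext ?_) (Units.ext ?_))
    · rw [hy, hy']
    · rw [hz, hz']
  · intro s hs
    simp only [Finset.mem_filter, Finset.mem_univ, true_and] at hs
    obtain ⟨h0, h1, h2, h3, h4⟩ := hs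
    have h1' : -1 - s ≠ 0 := fun h => h1 (by linear_combination -h)
    obtain ⟨l, hl⟩ := Finite.surjective_of_injective hinj (Units.mk0 s h0 * Units.mk0 _ h1')⁻¹
    have hl0 := l.ne_zero
    refine ⟨(l, Units.mk0 s h0 * l, Units.mk0 _ h1' * l), ?_, ?_⟩
    · simp only [orderedZeroSumTriples, Finset.mem_filter, Finset.mem_univ, true_and, ne_eq,
        Units.ext_iff, Units.val_mul, Units.val_mk0, Units.val_one]
      refine ⟨⟨fun h => h2 ?_, fun h => h3 ?_, fun h => h4 ?_⟩, by ring, ?_⟩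
      · exact mul_right_cancel₀ hl0 (by linear_combination -h)
      · exact mul_right_cancel₀ hl0 (by linear_combination h)
      · exact (mul_eq_zero.1 (show (2 * s + 1) * (l : K) = 0 by
          linear_combination h)).resolve_right hl0
      · have := congrArg Units.val (mul_eq_one_iff_eq_inv.2 hl)
        simp only [Units.val_mul, Units.val_mk0, Units.val_one, Units.val_pow_eq_pow_val] at this
        linear_combination this
    · simp [hl0]

lemma card_filter_of_char_two [CharP K 2] :
    (Finset.univ.filter fun s : K =>
      s ≠ 0 ∧ s ≠ -1 ∧ s ≠ 1 ∧ s ≠ -2 ∧ 2 * s + 1 ≠ 0).card = Fintype.card K - 2 := by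
  have h2 : (2 : K) = 0 := CharP.cast_eq_zero K 2
  have : (Finset.univ.filter fun s : K => s ≠ 0 ∧ s ≠ -1 ∧ s ≠ 1 ∧ s ≠ -2 ∧ 2 * s + 1 ≠ 0) =
      ({0, 1} : Finset K)ᶜ := by
    ext s
    simp [h2, CharTwo.neg_eq]
    tauto
  rw [this, Finset.card_compl, Finset.card_pair zero_ne_one]

lemma card_filter_of_char_three [CharP K 3] :
    (Finset.univ.filter fun s : K =>
      s ≠ 0 ∧ s ≠ -1 ∧ s ≠ 1 ∧ s ≠ -2 ∧ 2 * s + 1 ≠ 0).card = Fintype.card K - 3 := by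
  have h3 : (3 : K) = 0 := CharP.cast_eq_zero K 3
  have h2 : (2 : K) = -1 := by linear_combination h3
  have h : ∀ s : K, 2 * s + 1 ≠ 0 ↔ s ≠ 1 := fun s => by
    rw [not_iff_not, h2]
    constructor <;> intro h <;> linear_combination -h
  have : (Finset.univ.filter fun s : K => s ≠ 0 ∧ s ≠ -1 ∧ s ≠ 1 ∧ s ≠ -2 ∧ 2 * s + 1 ≠ 0) =
      ({0, -1, 1} : Finset K)ᶜ := by
    ext s
    simp only [h]
    simp [h2]
  have hne : (-1 : K) ≠ 1 := fun h => one_ne_zero (α := K) (by linear_combination h + h3)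
  rw [this, Finset.card_compl, Finset.card_insert_of_notMem (by simp), Finset.card_pair hne]

lemma card_filter_of_char_gt_three (h2 : (2 : K) ≠ 0) (h3 : (3 : K) ≠ 0) :
    (Finset.univ.filter fun s : K =>
      s ≠ 0 ∧ s ≠ -1 ∧ s ≠ 1 ∧ s ≠ -2 ∧ 2 * s + 1 ≠ 0).card = Fintype.card K - 5 := by
  have h : ∀ s : K, 2 * s + 1 ≠ 0 ↔ s ≠ -1 / 2 := fun s => by
    rw [not_iff_not, eq_div_iff h2]
    constructor <;> intro h <;> linear_combination h
  have : (Finset.univ.filter fun s : K => s ≠ 0 ∧ s ≠ -1 ∧ s ≠ 1 ∧ s ≠ -2 ∧ 2 * s + 1 ≠ 0) =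
      ({0, -1, 1, -2, -1 / 2} : Finset K)ᶜ := by
    ext s
    simp only [h]
    simp
  have a1 : (-1 : K) ≠ 1 := fun h => h2 (by linear_combination -h)
  have a2 : (-1 : K) ≠ -2 := fun h => one_ne_zero (α := K) (by linear_combination h)
  have a3 : (-1 : K) ≠ -1 / 2 := fun h => one_ne_zero (α := K) (by
    rw [eq_div_iff h2] at h; linear_combination -h)
  have a4 : (1 : K) ≠ -2 := fun h => h3 (by linear_combination h)
  have a5 : (1 : K) ≠ -1 / 2 := fun h => h3 (by
    rw [eq_div_iff h2] at h; linear_combination h)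
  have a6 : (-2 : K) ≠ -1 / 2 := fun h => h3 (by
    rw [eq_div_iff h2] at h; linear_combination -h)
  have a7 : (0 : K) ≠ -1 / 2 := fun h => one_ne_zero (α := K) (by
    rw [eq_div_iff h2] at h; linear_combination h)
  rw [this, Finset.card_compl, Finset.card_insert_of_notMem (by
    simp only [Finset.mem_insert, Finset.mem_singleton, not_or]
    exact ⟨by simp, by simp, by simpa using h2, a7⟩), Finset.card_insert_of_notMem (by
    simp only [Finset.mem_insert, Finset.mem_singleton, not_or]
    exact ⟨a1, a2, a3⟩), Finset.card_insert_of_notMem (by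
    simp only [Finset.mem_insert, Finset.mem_singleton, not_or]
    exact ⟨a4, a5⟩), Finset.card_pair a6]

end Counting

lemma hTop_two_eq_zero_of_lt_three {n : ℕ} [NeZero n] (hn : n < 3) (F : Type*) [Field F]
    (A : Finset (ZMod n)) : hTop n F 2 A = 0 := by
  have h : sumComplexFacets n 2 A = ∅ := by
    refine Finset.filter_eq_empty_iff.2 fun σ _ hσ => ?_
    have := Finset.card_le_univ σ
    rw [ZMod.card] at this
    omega
  have hV : Submodule.span F (ind n F '' ↑(sumComplexFacets n 2 A)) = ⊥ := by
    rw [h]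
    simp
  refine Nat.eq_zero_of_le_zero ((Submodule.finrank_le _).trans ?_)
  rw [hV, finrank_bot]

lemma six_mul_hTop_zero_one_three {n : ℕ} [NeZero n] {F K : Type*} [Field F] [Field K]
    [Algebra F K] [Fintype K] [DecidableEq K] (hK : Fintype.card K = n + 1) (hn : 4 ≤ n)
    (hcop : n.Coprime 3) :
    6 * hTop n F 2 ({0, 1, 3} : Finset (ZMod n)) = (Finset.univ.filter fun s : K =>
      s ≠ 0 ∧ s ≠ -1 ∧ s ≠ 1 ∧ s ≠ -2 ∧ 2 * s + 1 ≠ 0).card := by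
  have : Module.Finite F K := Module.Finite.of_finite
  rw [hTop_two_eq_finrank_altCycles, finrank_altCycles_baseChange F K,
    finrank_altCycles_zero_one_three hK hn hcop, six_mul_card_zeroSumTriples,
    card_orderedZeroSumTriples hK hcop]

/-- for `p` prime, `m ≥ 1` and `n = p^m - 1` coprime to `3`, with `k = 2`
and `A = {0,1,3} ⊆ ℤ_n`, `h_2(X_A; 𝔽_p)` equals `(n-1)/6` if `p = 2`, `(n-2)/6` if
`p = 3` and `(n-4)/6` if `p > 3`. -/
theorem h1_of_013_special (p m : ℕ) [Fact p.Prime] (hm : 0 < m) (n : ℕ) [NeZero n]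
    (hn : n = p ^ m - 1) (hcop : Nat.Coprime n 3) :
    (p = 2 → 6 * hTop n (ZMod p) 2 ({0, 1, 3} : Finset (ZMod n)) = n - 1) ∧
    (p = 3 → 6 * hTop n (ZMod p) 2 ({0, 1, 3} : Finset (ZMod n)) = n - 2) ∧
    (3 < p → 6 * hTop n (ZMod p) 2 ({0, 1, 3} : Finset (ZMod n)) = n - 4) := by
  classical
  by_cases h4 : 4 ≤ n
  · let K := GaloisField p m
    have : Fintype K := Fintype.ofFinite K
    have hK : Fintype.card K = n + 1 := by
      rw [← Nat.card_eq_fintype_card, GaloisField.card p m hm.ne']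
      omega
    rw [six_mul_hTop_zero_one_three (K := K) hK h4 hcop]
    refine ⟨?_, ?_, fun hp => ?_⟩
    · rintro rfl
      rw [card_filter_of_char_two, hK]
      omega
    · rintro rfl
      rw [card_filter_of_char_three, hK]
      omega
    · have hne : ∀ k : ℕ, 0 < k → k ≤ 3 → (k : K) ≠ 0 := fun k hk hk3 h0 => by
        have := Nat.le_of_dvd hk ((CharP.cast_eq_zero_iff K p k).1 h0)
        omega
      rw [card_filter_of_char_gt_three (by exact_mod_cast hne 2 (by norm_num) (by norm_num))
        (by exact_mod_cast hne 3 (by norm_num) (by norm_num)), hK]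
      omega
  · have h3 : n ≠ 3 := by
      rintro rfl
      norm_num at hcop
    rw [hTop_two_eq_zero_of_lt_three (by omega)]
    have hp1 : p ≤ p ^ m := Nat.le_self_pow hm.ne' p
    refine ⟨?_, ?_, fun hp => by omega⟩
    · rintro rfl
      have : 2 ∣ 2 ^ m := dvd_pow_self 2 hm.ne'
      omega
    · rintro rfl
      have : 3 ∣ 3 ^ m := dvd_pow_self 3 hm.ne'
      omega
end

section
/- Let p be a prime, let n, k be positive integers with k+1 coprime to n and p not dividing n, and let A ⊆ ℤ_n with |A| = k+1. Then h_k(X_A;𝔽_p) = 0 (i.e. the boundaries of the facets of X_A are linearly independent over 𝔽_p) if and only if for every nonzero polynomial f in the span over the algebraic closure of 𝔽_p of the monomials {x^a : a ∈ A} (exponents taken via representatives in {0,…,n−1}), the degree of gcd(f(x), x^n − 1) is at most k. -/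
open scoped BigOperators

namespace SumComplex

lemma exists_enumeration {α : Type*} [DecidableEq α] {m : ℕ} (σ : Finset α) (h : σ.card = m) :
    ∃ x : Fin m → α, Function.Injective x ∧ Finset.univ.image x = σ := by
  let e := (Finset.equivFinOfCardEq h).symm
  refine ⟨fun i => e i, Subtype.val_injective.comp e.injective, ?_⟩
  ext a
  simp only [Finset.mem_image, Finset.mem_univ, true_and]
  refine ⟨?_, fun ha => ⟨e.symm ⟨a, ha⟩, by simp⟩⟩
  rintro ⟨i, rfl⟩
  exact (e i).2

section Orientation

variable {n : ℕ} [NeZero n] {m : ℕ}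

/-- The sign of the permutation sorting the tuple `x` by representatives, or `0` if `x` is not
injective; computed as the sign of a Vandermonde determinant. -/
noncomputable def orient (x : Fin m → ZMod n) : ℤ :=
  Int.sign (Matrix.vandermonde (fun i => ((x i).val : ℤ))).det

lemma val_cast_injective : Function.Injective (fun a : ZMod n => (a.val : ℤ)) :=
  Nat.cast_injective.comp (ZMod.val_injective n)

lemma orient_eq_zero {x : Fin m → ZMod n} (h : ¬ Function.Injective x) : orient x = 0 := by
  rw [orient, Int.sign_eq_zero_iff_zero]
  by_contra h0
  exact h fun i j hij => Matrix.det_vandermonde_ne_zero_iff.1 h0 (by simp [hij])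

lemma orient_mul_self {x : Fin m → ZMod n} (h : Function.Injective x) :
    orient x * orient x = 1 := by
  have h0 : (Matrix.vandermonde (fun i => ((x i).val : ℤ))).det ≠ 0 :=
    Matrix.det_vandermonde_ne_zero_iff.2 (val_cast_injective.comp h)
  rcases lt_or_gt_of_ne h0 with h | h
  · rw [orient, Int.sign_eq_neg_one_of_neg h]; rfl
  · rw [orient, Int.sign_eq_one_of_pos h]; rfl

lemma orient_perm (x : Fin m → ZMod n) (π : Equiv.Perm (Fin m)) :
    orient (x ∘ π) = Equiv.Perm.sign π * orient x := by
  have : Matrix.vandermonde (fun i => (((x ∘ π) i).val : ℤ)) =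
      (Matrix.vandermonde (fun i => ((x i).val : ℤ))).submatrix π id := by
    ext i j; simp [Matrix.vandermonde_apply]
  rw [orient, this, Matrix.det_permute, Int.sign_mul, orient]
  congr 1
  rcases Int.units_eq_one_or (Equiv.Perm.sign π) with h | h <;> simp [h]

lemma sign_prod {ι : Type*} (s : Finset ι) (f : ι → ℤ) :
    Int.sign (∏ i ∈ s, f i) = ∏ i ∈ s, Int.sign (f i) :=
  map_prod (⟨⟨Int.sign, Int.sign_one⟩, Int.sign_mul⟩ : ℤ →* ℤ) f s

lemma orient_cons (a : ZMod n) {x : Fin m → ZMod n} (hx : Function.Injective x) :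
    orient (Fin.cons a x : Fin (m + 1) → ZMod n) = if a ∈ Finset.univ.image x then 0 else
      (-1) ^ ((Finset.univ.image x).filter (fun y => y.val < a.val)).card * orient x := by
  split_ifs with ha
  · refine orient_eq_zero fun h => ?_
    obtain ⟨i, -, hi⟩ := Finset.mem_image.1 ha
    exact Fin.succ_ne_zero i (h (by simpa using hi))
  · have hdet : (Matrix.vandermonde
        (fun i => (((Fin.cons a x : Fin (m + 1) → ZMod n) i).val : ℤ))).det =
        (∏ j, (((x j).val : ℤ) - a.val)) * (Matrix.vandermonde (fun i => ((x i).val : ℤ))).det := by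
      simp [Matrix.det_vandermonde, Fin.prod_univ_succ, Fin.prod_Ioi_succ]
    rw [orient, hdet, Int.sign_mul, sign_prod, orient]
    congr 1
    have hs : ∀ j, Int.sign (((x j).val : ℤ) - a.val) =
        if (x j).val < a.val then -1 else 1 := by
      intro j
      have hne : (x j).val ≠ a.val := fun h =>
        ha (Finset.mem_image.2 ⟨j, Finset.mem_univ _, ZMod.val_injective n h⟩)
      split_ifs with h
      · exact Int.sign_eq_neg_one_of_neg (by omega)
      · exact Int.sign_eq_one_of_pos (by omega)
    rw [Finset.prod_congr rfl fun j _ => hs j, ← Finset.prod_filter, Finset.prod_const,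
      Finset.filter_image, Finset.card_image_of_injective _ hx]

end Orientation

section Boundary

variable {n : ℕ} [NeZero n] {m : ℕ} {F : Type*} [Field F]

lemma bdry_apply (c : Finset (ZMod n) → F) (τ : Finset (ZMod n)) :
    bdry n F c τ = ∑ a, if a ∈ τ then 0 else
      (-1 : F) ^ (τ.filter (fun y => y.val < a.val)).card * c (insert a τ) := by
  have h1 : bdry n F c τ = ∑ a, ∑ σ : Finset (ZMod n), if a ∈ σ ∧ τ = σ.erase a then
      c σ * (-1 : F) ^ (σ.filter (fun y => y.val < a.val)).card else 0 := by
    rw [Finset.sum_comm]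
    refine Finset.sum_congr rfl fun σ _ => ?_
    rw [bdryCoeff, Finset.mul_sum, ← Finset.sum_filter_add_sum_filter_not Finset.univ (· ∈ σ)]
    rw [Finset.sum_eq_zero (s := Finset.univ.filter (· ∉ σ)), add_zero, Finset.filter_univ_mem]
    · refine Finset.sum_congr rfl fun a ha => ?_
      simp [ha]
    · intro a ha
      simp [(Finset.mem_filter.1 ha).2]
  rw [h1]
  refine Finset.sum_congr rfl fun a _ => ?_
  split_ifs with ha
  · refine Finset.sum_eq_zero fun σ _ => if_neg ?_
    rintro ⟨-, rfl⟩
    simp at ha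
  · rw [Finset.sum_eq_single (insert a τ)]
    · rw [if_pos ⟨Finset.mem_insert_self _ _, (Finset.erase_insert ha).symm⟩,
        Finset.filter_insert, if_neg (lt_irrefl _), mul_comm]
    · rintro σ - hσ
      refine if_neg ?_
      rintro ⟨h, rfl⟩
      exact hσ (Finset.insert_erase h).symm
    · simp

/-- The alternating function on tuples attached to a function on finite sets. -/
noncomputable def alt (m : ℕ) (c : Finset (ZMod n) → F) (x : Fin m → ZMod n) : F :=
  (orient x : F) * c (Finset.univ.image x)

lemma alt_eq_zero (c : Finset (ZMod n) → F) {x : Fin m → ZMod n}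
    (h : ¬ Function.Injective x) : alt m c x = 0 := by
  simp [alt, orient_eq_zero h]

lemma alt_perm (c : Finset (ZMod n) → F) (x : Fin m → ZMod n) (π : Equiv.Perm (Fin m)) :
    alt m c (x ∘ π) = ((Equiv.Perm.sign π : ℤ) : F) * alt m c x := by
  have : Finset.univ.image (x ∘ π) = Finset.univ.image x := by
    rw [← Finset.image_image, Finset.image_univ_equiv]
  rw [alt, orient_perm, this, alt]
  push_cast
  ring

lemma orient_mul_alt (c : Finset (ZMod n) → F) {x : Fin m → ZMod n}
    (h : Function.Injective x) : (orient x : F) * alt m c x = c (Finset.univ.image x) := by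
  rw [alt, ← mul_assoc, ← Int.cast_mul, orient_mul_self h, Int.cast_one, one_mul]

lemma eq_zero_of_alt_eq_zero {c : Finset (ZMod n) → F} (h : ∀ x, alt m c x = 0)
    {σ : Finset (ZMod n)} (hσ : σ.card = m) : c σ = 0 := by
  obtain ⟨x, hx, rfl⟩ := exists_enumeration σ hσ
  rw [← orient_mul_alt c hx, h, mul_zero]

lemma sum_alt_cons (c : Finset (ZMod n) → F) (x : Fin m → ZMod n) :
    ∑ a, alt (m + 1) c (Fin.cons a x) = alt m (bdry n F c) x := by
  by_cases hx : Function.Injective x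
  · rw [alt, bdry_apply, Finset.mul_sum]
    refine Finset.sum_congr rfl fun a _ => ?_
    have hi : Finset.univ.image (Fin.cons a x : Fin (m + 1) → ZMod n) =
        insert a (Finset.univ.image x) := by
      ext b; simp [Fin.exists_fin_succ, eq_comm]
    rw [alt, orient_cons a hx, hi]
    split_ifs
    · simp
    · push_cast; ring
  · rw [alt_eq_zero _ hx]
    refine Finset.sum_eq_zero fun a _ => alt_eq_zero c fun h => hx fun i j hij => ?_
    exact Fin.succ_injective _ (h (by simpa using hij))

lemma exists_alt_eq (D : (Fin m → ZMod n) → F)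
    (hD : ∀ x (π : Equiv.Perm (Fin m)), D (x ∘ π) = ((Equiv.Perm.sign π : ℤ) : F) * D x)
    (hD0 : ∀ x, ¬ Function.Injective x → D x = 0) :
    ∃ c : Finset (ZMod n) → F, (∀ x, alt m c x = D x) ∧ ∀ σ, σ.card ≠ m → c σ = 0 := by
  choose e he hie using fun (σ : Finset (ZMod n)) (h : σ.card = m) => exists_enumeration σ h
  refine ⟨fun σ => if h : σ.card = m then (orient (e σ h) : F) * D (e σ h) else 0,
    fun x => ?_, fun σ hσ => dif_neg hσ⟩
  by_cases hx : Function.Injective x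
  · have hc : (Finset.univ.image x).card = m := by
      rw [Finset.card_image_of_injective _ hx, Finset.card_univ, Fintype.card_fin]
    rw [alt, dif_pos hc]
    set y := e _ hc with hy
    have hxy : ∀ i, ∃ j, x j = y i := fun i => by
      have : y i ∈ Finset.univ.image x := by
        rw [← hie _ hc]; exact Finset.mem_image_of_mem _ (Finset.mem_univ i)
      simpa using this
    choose g hg using hxy
    have hgi : Function.Injective g := fun i j hij => he _ hc (by
      change y i = y j
      rw [← hg, ← hg, hij])
    have hyx : y = x ∘ Equiv.ofBijective g (Finite.injective_iff_bijective.1 hgi) :=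
      funext fun i => (hg i).symm
    rw [hyx, orient_perm, hD]
    have h1 : (orient x : F) * orient x = 1 := by
      rw [← Int.cast_mul, orient_mul_self hx, Int.cast_one]
    generalize Equiv.ofBijective g _ = π
    have h2 : ((Equiv.Perm.sign π : ℤ) : F) * ((Equiv.Perm.sign π : ℤ) : F) = 1 := by
      rcases Int.units_eq_one_or (Equiv.Perm.sign π) with h | h <;> simp [h]
    push_cast
    linear_combination D x * h2 + D x * (((Equiv.Perm.sign π : ℤ) : F) ^ 2) * h1
  · rw [alt_eq_zero _ hx, hD0 _ hx]

lemma bdry_eq_zero_of_sum_alt_eq_zero {c : Finset (ZMod n) → F}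
    (hc : ∀ σ, σ.card ≠ m + 1 → c σ = 0)
    (h : ∀ x : Fin m → ZMod n, ∑ a, alt (m + 1) c (Fin.cons a x) = 0) :
    bdry n F c = 0 := by
  funext τ
  by_cases hτ : τ.card = m
  · exact eq_zero_of_alt_eq_zero (fun x => (sum_alt_cons c x).symm.trans (h x)) hτ
  · rw [bdry_apply]
    refine Finset.sum_eq_zero fun a _ => ?_
    split_ifs with ha
    · rfl
    · rw [hc, mul_zero]
      rw [Finset.card_insert_of_notMem ha]
      omega

lemma mem_span_ind_iff (S : Finset (Finset (ZMod n))) (c : Finset (ZMod n) → F) :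
    c ∈ Submodule.span F (ind n F '' ↑S) ↔ ∀ σ ∉ S, c σ = 0 := by
  constructor
  · intro h
    induction h using Submodule.span_induction with
    | mem x hx =>
      obtain ⟨τ, hτ, rfl⟩ := hx
      intro σ hσ
      exact if_neg fun h : σ = τ => hσ (by rw [h]; exact hτ)
    | zero => intro _ _; rfl
    | add x y _ _ hx hy => intro σ hσ; simp [hx σ hσ, hy σ hσ]
    | smul a x _ hx => intro σ hσ; simp [hx σ hσ]
  · intro h
    have : c = ∑ σ ∈ S, c σ • ind n F σ := by
      funext τ
      simp only [Finset.sum_apply, Pi.smul_apply, ind, smul_eq_mul, mul_ite, mul_one, mul_zero,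
        Finset.sum_ite_eq]
      split_ifs with hτ
      · rfl
      · exact h τ hτ
    rw [this]
    exact Submodule.sum_mem _ fun σ hσ => Submodule.smul_mem _ _
      (Submodule.subset_span ⟨σ, hσ, rfl⟩)

lemma hTop_eq_zero_iff (k : ℕ) (A : Finset (ZMod n)) :
    hTop n F k A = 0 ↔ ∀ c : Finset (ZMod n) → F,
      (∀ σ ∉ sumComplexFacets n k A, c σ = 0) → bdry n F c = 0 → c = 0 := by
  rw [hTop, Submodule.finrank_eq_zero, LinearMap.ker_eq_bot']
  constructor
  · intro h c hc hb
    exact congrArg Subtype.val (h ⟨c, (mem_span_ind_iff _ c).2 hc⟩ hb)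
  · rintro h ⟨c, hc⟩ hb
    exact Subtype.ext (h c ((mem_span_ind_iff _ c).1 hc) hb)

lemma bdry_map {K : Type*} [Field K] [Algebra F K] (c : Finset (ZMod n) → F)
    (τ : Finset (ZMod n)) :
    bdry n K (fun σ => algebraMap F K (c σ)) τ = algebraMap F K (bdry n F c τ) := by
  simp [bdry_apply, apply_ite (algebraMap F K)]

lemma bdry_dual {K : Type*} [Field K] [Algebra F K] (φ : Module.Dual F K)
    (c : Finset (ZMod n) → K) (τ : Finset (ZMod n)) :
    bdry n F (fun σ => φ (c σ)) τ = φ (bdry n K c τ) := by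
  rw [bdry_apply, bdry_apply, map_sum]
  refine Finset.sum_congr rfl fun a _ => ?_
  split_ifs
  · simp
  · rcases neg_one_pow_eq_or ℤ (τ.filter (fun y => y.val < a.val)).card with h | h <;>
    · have hF := congrArg (Int.cast : ℤ → F) h
      have hK := congrArg (Int.cast : ℤ → K) h
      push_cast at hF hK
      rw [hF, hK]
      simp

/-- Acyclicity is insensitive to extension of the field of coefficients. -/
lemma hTop_eq_zero_iff_extension (K : Type*) [Field K] [Algebra F K] (k : ℕ)
    (A : Finset (ZMod n)) : hTop n F k A = 0 ↔ hTop n K k A = 0 := by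
  rw [hTop_eq_zero_iff, hTop_eq_zero_iff]
  constructor
  · intro h c hc hb
    funext σ
    refine (Module.forall_dual_apply_eq_zero_iff F (c σ)).1 fun φ => ?_
    refine congrFun (h (fun σ => φ (c σ)) (fun σ hσ => by rw [hc σ hσ, map_zero]) ?_) σ
    funext τ
    rw [bdry_dual, hb]
    exact map_zero φ
  · intro h c hc hb
    have := h (fun σ => algebraMap F K (c σ)) (fun σ hσ => by rw [hc σ hσ, map_zero]) (by
      funext τ
      rw [bdry_map, hb]
      exact map_zero _)
    funext σ
    exact (algebraMap F K).injective ((congrFun this σ).trans (map_zero _).symm)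

end Boundary

section Fourier

variable {n m k : ℕ} {K : Type*} [Field K] {ψ : AddChar (ZMod n) K}

/-- The alternating function on tuples built from coefficients `b` and points `z`. -/
noncomputable def detCochain (ψ : AddChar (ZMod n) K) (b : ZMod n → K) (z x : Fin m → ZMod n) :
    K :=
  b (∑ i, x i) * (Matrix.of fun i j => ψ (x i * z j)).det

lemma detCochain_perm (b : ZMod n → K) (z x : Fin m → ZMod n) (π : Equiv.Perm (Fin m)) :
    detCochain ψ b z (x ∘ π) = ((Equiv.Perm.sign π : ℤ) : K) * detCochain ψ b z x := by
  have h : (Matrix.of fun i j => ψ ((x ∘ π) i * z j)) =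
      (Matrix.of fun i j => ψ (x i * z j)).submatrix π id := rfl
  have hs : ∑ i, (x ∘ π) i = ∑ i, x i := Equiv.sum_comp π x
  rw [detCochain, h, hs, Matrix.det_permute, detCochain]
  ring

lemma detCochain_eq_zero (b : ZMod n → K) (z : Fin m → ZMod n) {x : Fin m → ZMod n}
    (hx : ¬ Function.Injective x) : detCochain ψ b z x = 0 := by
  simp only [Function.Injective, not_forall] at hx
  obtain ⟨i, j, hij, hne⟩ := hx
  rw [detCochain, Matrix.det_zero_of_row_eq hne (by ext l; simp [hij]), mul_zero]

lemma exists_detCochain_ne_zero (hψ : Function.Injective ψ) (hm : Nat.Coprime m n)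
    {b : ZMod n → K} (hb : b ≠ 0) {z : Fin m → ZMod n} (hz : Function.Injective z) :
    ∃ x, detCochain ψ b z x ≠ 0 := by
  obtain ⟨a, ha⟩ := Function.ne_iff.1 hb
  set s : ZMod n := ∑ i : Fin m, ((i : ℕ) : ZMod n)
  set t : ZMod n := (m : ZMod n)⁻¹ * (a - s)
  refine ⟨fun i => ((i : ℕ) : ZMod n) + t, mul_ne_zero ?_ ?_⟩
  · have : ∑ i : Fin m, (((i : ℕ) : ZMod n) + t) = a := by
      rw [Finset.sum_add_distrib, Finset.sum_const, Finset.card_univ, Fintype.card_fin,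
        nsmul_eq_mul, ← mul_assoc, ZMod.coe_mul_inv_eq_one m hm, one_mul]
      ring
    rwa [this]
  · have : (Matrix.of fun i j : Fin m => ψ ((((i : ℕ) : ZMod n) + t) * z j)) =
        Matrix.of fun i j => ψ (t * z j) * (Matrix.vandermonde fun j => ψ (z j)).transpose i j := by
      ext i j
      simp only [Matrix.of_apply, Matrix.transpose_apply, Matrix.vandermonde_apply]
      rw [← AddChar.map_nsmul_eq_pow, nsmul_eq_mul, ← AddChar.map_add_eq_mul]
      congr 1
      ring
    rw [this, Matrix.det_mul_row, Matrix.det_transpose]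
    refine mul_ne_zero (Finset.prod_ne_zero_iff.2 fun j _ => (ψ.val_isUnit _).ne_zero) ?_
    exact Matrix.det_vandermonde_ne_zero_iff.2 (hψ.comp hz)

lemma addChar_sum {ι G : Type*} [AddCommMonoid G] (χ : AddChar G K) (s : Finset ι) (f : ι → G) :
    χ (∑ i ∈ s, f i) = ∏ i ∈ s, χ (f i) :=
  map_prod χ.toMonoidHom (fun i => Multiplicative.ofAdd (f i)) s

variable [NeZero n]

/-- The unnormalised Fourier transform of a function on `m`-tuples. -/
noncomputable def fourier (ψ : AddChar (ZMod n) K) (f : (Fin m → ZMod n) → K)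
    (y : Fin m → ZMod n) : K :=
  ∑ x, f x * ∏ i, ψ (x i * y i)

lemma sum_fourier_mul (hψ : ψ.IsPrimitive) (f : (Fin m → ZMod n) → K) (x : Fin m → ZMod n) :
    ∑ y, fourier ψ f y * ∏ i, ψ (-(x i * y i)) = (n : K) ^ m * f x := by
  have h1 : ∀ x' : Fin m → ZMod n,
      ∑ y : Fin m → ZMod n, (∏ i, ψ (x' i * y i)) * ∏ i, ψ (-(x i * y i)) =
        if x' = x then (n : K) ^ m else 0 := by
    intro x'
    have h2 : ∀ y : Fin m → ZMod n, (∏ i, ψ (x' i * y i)) * ∏ i, ψ (-(x i * y i)) =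
        ∏ i, ψ (y i * (x' i - x i)) := by
      intro y
      rw [← Finset.prod_mul_distrib]
      refine Finset.prod_congr rfl fun i _ => ?_
      rw [← AddChar.map_add_eq_mul]
      congr 1
      ring
    rw [Finset.sum_congr rfl fun y _ => h2 y, ← Fintype.piFinset_univ,
      ← Finset.prod_univ_sum (fun _ => Finset.univ) fun i b => ψ (b * (x' i - x i))]
    simp_rw [AddChar.sum_mulShift _ hψ, ZMod.card]
    split_ifs with h
    · simp [h]
    · obtain ⟨i, hi⟩ := Function.ne_iff.1 h
      exact Finset.prod_eq_zero (Finset.mem_univ i) (by simp [sub_eq_zero, hi])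
  simp_rw [fourier, Finset.sum_mul]
  rw [Finset.sum_comm]
  simp_rw [mul_assoc, ← Finset.mul_sum, h1]
  simp [mul_comm]

lemma eq_zero_of_fourier_eq_zero (hn : (n : K) ≠ 0) (hψ : ψ.IsPrimitive)
    {f : (Fin m → ZMod n) → K} (h : ∀ y, fourier ψ f y = 0) (x : Fin m → ZMod n) : f x = 0 := by
  have := sum_fourier_mul hψ f x
  simp only [h, zero_mul, Finset.sum_const_zero] at this
  exact (mul_eq_zero.1 this.symm).resolve_left (pow_ne_zero _ hn)

lemma fourier_alt_eq_zero_of_not_injective (c : Finset (ZMod n) → K) {y : Fin m → ZMod n}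
    (hy : ¬ Function.Injective y) : fourier ψ (alt m c) y = 0 := by
  simp only [Function.Injective, not_forall] at hy
  obtain ⟨i, j, hij, hne⟩ := hy
  refine Finset.sum_involution (fun x _ => x ∘ Equiv.swap i j) (fun x _ => ?_) (fun x _ hx h => ?_)
    (fun _ _ => Finset.mem_univ _) (fun x _ => ?_)
  · have : ∏ l, ψ ((x ∘ Equiv.swap i j) l * y l) = ∏ l, ψ (x l * y l) := by
      rw [← Equiv.prod_comp (Equiv.swap i j)]
      refine Finset.prod_congr rfl fun l _ => ?_
      simp only [Function.comp_apply, Equiv.swap_apply_self]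
      congr 2
      rw [Equiv.swap_apply_def]
      split_ifs with h1 h2
      · rw [h1, hij]
      · rw [h2, hij]
      · rfl
    rw [this, alt_perm, Equiv.Perm.sign_swap hne]
    simp
  · have hx' : Function.Injective x := by
      by_contra h0
      exact hx (by rw [alt_eq_zero c h0, zero_mul])
    have := congrFun h i
    simp only [Function.comp_apply, Equiv.swap_apply_left] at this
    exact hne (hx' this).symm
  · funext l
    simp

lemma fourier_alt_perm (c : Finset (ZMod n) → K) (y : Fin m → ZMod n)
    (π : Equiv.Perm (Fin m)) :
    fourier ψ (alt m c) (y ∘ π) = ((Equiv.Perm.sign π : ℤ) : K) * fourier ψ (alt m c) y := by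
  rw [fourier, fourier, Finset.mul_sum,
    ← (Equiv.arrowCongr π.symm (Equiv.refl (ZMod n))).sum_comp]
  refine Finset.sum_congr rfl fun x _ => ?_
  have h : Equiv.arrowCongr π.symm (Equiv.refl (ZMod n)) x = x ∘ π := by
    funext i; simp [Equiv.arrowCongr]
  rw [h, alt_perm, ← mul_assoc]
  congr 1
  exact Equiv.prod_comp π fun i => ψ (x i * y i)

lemma fourier_alt_eq_zero_of_bdry (c : Finset (ZMod n) → K) (hc : bdry n K c = 0)
    {y : Fin (m + 1) → ZMod n} {i : Fin (m + 1)} (hy : y i = 0) :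
    fourier ψ (alt (m + 1) c) y = 0 := by
  have h0 : ∀ y : Fin (m + 1) → ZMod n, y 0 = 0 → fourier ψ (alt (m + 1) c) y = 0 := by
    intro y hy
    rw [fourier, ← (Fin.consEquiv fun _ => ZMod n).sum_comp, Fintype.sum_prod_type_right]
    refine Finset.sum_eq_zero fun x _ => ?_
    have : ∀ a : ZMod n, ∏ i, ψ ((Fin.cons a x : Fin (m + 1) → ZMod n) i * y i) =
        ∏ i : Fin m, ψ (x i * y i.succ) := by
      intro a
      simp [Fin.prod_univ_succ, hy]
    have h1 : ∀ a : ZMod n, (Fin.consEquiv fun _ => ZMod n) (a, x) =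
        (Fin.cons a x : Fin (m + 1) → ZMod n) := fun _ => rfl
    simp only [h1, this]
    rw [← Finset.sum_mul, sum_alt_cons, hc]
    simp [alt]
  have h1 := h0 (y ∘ Equiv.swap 0 i) (by simpa using hy)
  rw [fourier_alt_perm] at h1
  refine (mul_eq_zero.1 h1).resolve_left ?_
  rcases Int.units_eq_one_or (Equiv.Perm.sign (Equiv.swap 0 i)) with h | h <;> simp [h]

/-- The part of the Fourier transform carried by the tuples with sum `a`. -/
noncomputable def fourierPart (ψ : AddChar (ZMod n) K) (f : (Fin m → ZMod n) → K)
    (y : Fin m → ZMod n) (a : ZMod n) : K :=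
  ∑ x ∈ Finset.univ.filter (fun x => ∑ i, x i = a), f x * ∏ i, ψ (x i * y i)

lemma fourier_add_const (f : (Fin m → ZMod n) → K) (y : Fin m → ZMod n) (t : ZMod n) :
    fourier ψ f (fun i => y i + t) = ∑ a, fourierPart ψ f y a * ψ (a * t) := by
  rw [fourier, ← Finset.sum_fiberwise Finset.univ (fun x : Fin m → ZMod n => ∑ i, x i)]
  refine Finset.sum_congr rfl fun a _ => ?_
  rw [fourierPart, Finset.sum_mul]
  refine Finset.sum_congr rfl fun x hx => ?_
  obtain rfl := (Finset.mem_filter.1 hx).2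
  have : ∏ i, ψ (x i * (y i + t)) = (∏ i, ψ (x i * y i)) * ψ ((∑ i, x i) * t) := by
    rw [Finset.sum_mul, addChar_sum, ← Finset.prod_mul_distrib]
    exact Finset.prod_congr rfl fun i _ => by rw [mul_add, AddChar.map_add_eq_mul]
  rw [this, mul_assoc]

/-- If a nonzero exponential sum with frequencies in `A` never vanishes at `k + 1` distinct
points, then `X_A` has no nonzero `k`-cycles. -/
lemma hTop_eq_zero_of_forall (hn : (n : K) ≠ 0) (hψ : ψ.IsPrimitive) (A : Finset (ZMod n))
    (h : ∀ b : ZMod n → K, (∀ a ∉ A, b a = 0) → ∀ z : Fin (k + 1) → ZMod n,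
      Function.Injective z → (∀ j, ∑ a, b a * ψ (a * z j) = 0) → b = 0) :
    hTop n K k A = 0 := by
  rw [hTop_eq_zero_iff]
  intro c hc hb
  have hsupp : ∀ x : Fin (k + 1) → ZMod n, ∑ i, x i ∉ A → alt (k + 1) c x = 0 := by
    intro x hx
    by_cases hi : Function.Injective x
    · rw [alt, hc, mul_zero]
      rw [sumComplexFacets, Finset.mem_filter, Finset.sum_image hi.injOn]
      exact fun h => hx h.2.2
    · exact alt_eq_zero c hi
  have hF : ∀ y, fourier ψ (alt (k + 1) c) y = 0 := by
    intro y
    by_cases hy : Function.Injective y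
    · have hpart : fourierPart ψ (alt (k + 1) c) y = 0 := by
        refine h _ (fun a ha => Finset.sum_eq_zero fun x hx => ?_) (fun j => -y j)
          (neg_injective.comp hy) fun j => ?_
        · rw [hsupp x (by rwa [(Finset.mem_filter.1 hx).2]), zero_mul]
        · rw [← fourier_add_const]
          exact fourier_alt_eq_zero_of_bdry c hb (i := j) (by simp)
      have := fourier_add_const (ψ := ψ) (alt (k + 1) c) y 0
      simpa [hpart] using this
    · exact fourier_alt_eq_zero_of_not_injective c hy
  funext σ
  by_cases hσ : σ.card = k + 1
  · exact eq_zero_of_alt_eq_zero (eq_zero_of_fourier_eq_zero hn hψ hF) hσ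
  · exact hc σ fun hm => hσ (Finset.mem_filter.1 hm).2.1

lemma sum_detCochain_cons {b : ZMod n → K} {z : Fin (m + 1) → ZMod n}
    (h : ∀ j, ∑ a, b a * ψ (a * z j) = 0) (x : Fin m → ZMod n) :
    ∑ a, detCochain ψ b z (Fin.cons a x) = 0 := by
  have h1 : ∀ j, ∑ a, b (a + ∑ i, x i) * ψ (a * z j) = 0 := by
    intro j
    have h2 : ∑ a, b (a + ∑ i, x i) * ψ (a * z j) =
        (∑ a, b a * ψ (a * z j)) * ψ (-((∑ i, x i) * z j)) := by
      rw [Finset.sum_mul, ← Equiv.sum_comp (Equiv.addRight (∑ i, x i)) fun a =>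
        b a * ψ (a * z j) * ψ (-((∑ i, x i) * z j))]
      refine Finset.sum_congr rfl fun a _ => ?_
      rw [Equiv.coe_addRight, mul_assoc, ← AddChar.map_add_eq_mul]
      congr 2
      ring
    rw [h2, h, zero_mul]
  simp_rw [detCochain, Matrix.det_succ_row_zero, Finset.mul_sum]
  rw [Finset.sum_comm]
  refine Finset.sum_eq_zero fun j _ => ?_
  have h3 : ∀ a : ZMod n, b (∑ i, (Fin.cons a x : Fin (m + 1) → ZMod n) i) *
      ((-1) ^ (j : ℕ) * (Matrix.of fun i j =>
        ψ ((Fin.cons a x : Fin (m + 1) → ZMod n) i * z j)) 0 j *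
      ((Matrix.of fun i j => ψ ((Fin.cons a x : Fin (m + 1) → ZMod n) i * z j)).submatrix
        Fin.succ j.succAbove).det) =
      b (a + ∑ i, x i) * ψ (a * z j) * ((-1) ^ (j : ℕ) *
        (Matrix.of fun i l => ψ (x i * z (j.succAbove l))).det) := by
    intro a
    have : (Matrix.of fun i j => ψ ((Fin.cons a x : Fin (m + 1) → ZMod n) i * z j)).submatrix
        Fin.succ j.succAbove = Matrix.of fun i l => ψ (x i * z (j.succAbove l)) := by
      ext i l; simp
    rw [this, Fin.sum_cons, Matrix.of_apply, Fin.cons_zero]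
    ring
  rw [Finset.sum_congr rfl fun a _ => h3 a, ← Finset.sum_mul, h1, zero_mul]

/-- If `X_A` has no nonzero `k`-cycles, then a nonzero exponential sum with frequencies in `A`
does not vanish at `k + 1` distinct points. -/
lemma eq_zero_of_hTop_eq_zero (hψ : Function.Injective ψ) (hk : Nat.Coprime (k + 1) n)
    {A : Finset (ZMod n)} (h : hTop n K k A = 0) {b : ZMod n → K} (hb : ∀ a ∉ A, b a = 0)
    {z : Fin (k + 1) → ZMod n} (hz : Function.Injective z)
    (hbz : ∀ j, ∑ a, b a * ψ (a * z j) = 0) : b = 0 := by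
  by_contra hb0
  obtain ⟨c, hc, hc0⟩ := exists_alt_eq (detCochain ψ b z) (detCochain_perm b z)
    fun _ hx => detCochain_eq_zero b z hx
  have hbd : bdry n K c = 0 := bdry_eq_zero_of_sum_alt_eq_zero hc0 fun x => by
    simp_rw [hc]
    exact sum_detCochain_cons hbz x
  have hc' : c = 0 := by
    refine (hTop_eq_zero_iff k A).1 h c (fun σ hσ => ?_) hbd
    by_cases hcard : σ.card = k + 1
    · obtain ⟨x, hx, rfl⟩ := exists_enumeration σ hcard
      rw [← orient_mul_alt c hx, hc, detCochain, hb, zero_mul, mul_zero]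
      refine fun hA => hσ ?_
      rw [sumComplexFacets, Finset.mem_filter, Finset.sum_image hx.injOn]
      exact ⟨Finset.mem_univ _, hcard, hA⟩
    · exact hc0 σ hcard
  obtain ⟨x, hx⟩ := exists_detCochain_ne_zero hψ hk hb0 hz
  exact hx (by rw [← hc, hc']; simp [alt])

end Fourier

section Polynomials

open Polynomial

variable {n : ℕ} {K : Type*} [Field K]

lemma lt_natDegree_gcd_iff [DecidableEq K[X]] [IsAlgClosed K] (hn : (n : K) ≠ 0)
    {ψ : AddChar (ZMod n) K} (hψ : Function.Injective ψ)
    (hroots : ∀ r : K, r ^ n = 1 → ∃ t, ψ t = r) {f : K[X]} (hf : f ≠ 0) (k : ℕ) :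
    k < (EuclideanDomain.gcd f (X ^ n - 1)).natDegree ↔
      ∃ z : Fin (k + 1) → ZMod n, Function.Injective z ∧ ∀ j, f.eval (ψ (z j)) = 0 := by
  classical
  have hg : EuclideanDomain.gcd f (X ^ n - 1) ≠ 0 := fun h =>
    hf (EuclideanDomain.gcd_eq_zero_iff.1 h).1
  have hroot : ∀ r : K, r ∈ (EuclideanDomain.gcd f (X ^ n - 1)).roots ↔
      f.eval r = 0 ∧ r ^ n = 1 := by
    intro r
    have h : r ^ n = 1 ↔ (X - C r) ∣ (X ^ n - 1 : K[X]) := by simp [dvd_iff_isRoot, sub_eq_zero]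
    rw [mem_roots hg, ← IsRoot.def, ← dvd_iff_isRoot, ← dvd_iff_isRoot, h]
    exact ⟨fun hd => ⟨hd.trans (EuclideanDomain.gcd_dvd_left _ _),
      hd.trans (EuclideanDomain.gcd_dvd_right _ _)⟩, fun hd => EuclideanDomain.dvd_gcd hd.1 hd.2⟩
  have hnd : (EuclideanDomain.gcd f (X ^ n - 1)).roots.Nodup :=
    nodup_roots ((X_pow_sub_one_separable_iff.2 hn).of_dvd (EuclideanDomain.gcd_dvd_right _ _))
  constructor
  · intro h
    rw [(IsAlgClosed.splits _).natDegree_eq_card_roots, ← Multiset.toFinset_card_of_nodup hnd] at h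
    obtain ⟨S, hS, hcard⟩ := Finset.exists_subset_card_eq (Nat.succ_le_of_lt h)
    obtain ⟨r, hr, rfl⟩ := exists_enumeration S hcard
    have hr' : ∀ j, f.eval (r j) = 0 ∧ r j ^ n = 1 := fun j =>
      (hroot _).1 (Multiset.mem_toFinset.1 (hS (Finset.mem_image_of_mem _ (Finset.mem_univ j))))
    choose z hz using fun j => hroots (r j) (hr' j).2
    exact ⟨z, fun i j hij => hr (by rw [← hz, ← hz, hij]), fun j => by rw [hz]; exact (hr' j).1⟩
  · rintro ⟨z, hz, h⟩
    have hcard : (Finset.univ.image (ψ ∘ z)).card = k + 1 := by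
      rw [Finset.card_image_of_injective _ (hψ.comp hz), Finset.card_univ, Fintype.card_fin]
    refine Nat.lt_of_succ_le (hcard.symm.le.trans (card_le_degree_of_subset_roots fun r hr => ?_))
    obtain ⟨j, -, rfl⟩ := Finset.mem_image.1 (Finset.mem_def.2 hr)
    refine (hroot _).2 ⟨h j, ?_⟩
    rw [Function.comp_apply, ← AddChar.map_nsmul_eq_pow, nsmul_eq_mul, ZMod.natCast_self,
      zero_mul, AddChar.map_zero_eq_one]

variable [NeZero n]

lemma mem_span_monomials_iff (A : Finset (ZMod n)) (f : K[X]) :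
    f ∈ Submodule.span K {g : K[X] | ∃ a ∈ A, g = X ^ a.val} ↔
      ∃ b : ZMod n → K, (∀ a ∉ A, b a = 0) ∧ f = ∑ a, C (b a) * X ^ a.val := by
  constructor
  · intro h
    induction h using Submodule.span_induction with
    | mem x hx =>
      obtain ⟨a, ha, rfl⟩ := hx
      refine ⟨Pi.single a 1, fun b hb => Pi.single_eq_of_ne (by rintro rfl; exact hb ha) _, ?_⟩
      rw [Finset.sum_eq_single a] <;> simp +contextual
    | zero => exact ⟨0, fun _ _ => rfl, by simp⟩
    | add x y _ _ hx hy =>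
      obtain ⟨b, hb, rfl⟩ := hx
      obtain ⟨d, hd, rfl⟩ := hy
      exact ⟨b + d, fun a ha => by simp [hb a ha, hd a ha],
        by simp [add_mul, Finset.sum_add_distrib]⟩
    | smul r x _ hx =>
      obtain ⟨b, hb, rfl⟩ := hx
      exact ⟨r • b, fun a ha => by simp [hb a ha],
        by simp [Finset.smul_sum, smul_eq_C_mul, mul_assoc]⟩
  · rintro ⟨b, hb, rfl⟩
    refine Submodule.sum_mem _ fun a _ => ?_
    by_cases ha : a ∈ A
    · rw [← smul_eq_C_mul]
      exact Submodule.smul_mem _ _ (Submodule.subset_span ⟨a, ha, rfl⟩)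
    · simp [hb a ha]

lemma sum_monomials_ne_zero {b : ZMod n → K} (hb : b ≠ 0) :
    ∑ a, C (b a) * X ^ a.val ≠ (0 : K[X]) := by
  obtain ⟨a, ha⟩ := Function.ne_iff.1 hb
  intro h
  have := congrArg (fun f => coeff f a.val) h
  simp only [finsetSum_coeff, coeff_C_mul, coeff_X_pow, coeff_zero] at this
  rw [Finset.sum_eq_single a] at this
  · exact ha (by simpa using this)
  · intro c _ hc
    rw [if_neg fun h => hc (ZMod.val_injective n h).symm, mul_zero]
  · simp

lemma eval_sum_monomials (ψ : AddChar (ZMod n) K) (b : ZMod n → K) (t : ZMod n) :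
    (∑ a, C (b a) * X ^ a.val : K[X]).eval (ψ t) = ∑ a, b a * ψ (a * t) := by
  rw [eval_finsetSum]
  refine Finset.sum_congr rfl fun a _ => ?_
  rw [eval_mul, eval_C, eval_pow, eval_X, ← AddChar.map_nsmul_eq_pow, nsmul_eq_mul,
    ZMod.natCast_zmod_val]

lemma hTop_eq_zero_iff_gcd [DecidableEq K[X]] [IsAlgClosed K] (hn : (n : K) ≠ 0) {k : ℕ}
    (hk : Nat.Coprime (k + 1) n) (A : Finset (ZMod n)) :
    hTop n K k A = 0 ↔
      ∀ f ∈ Submodule.span K {g : K[X] | ∃ a ∈ A, g = X ^ a.val}, f ≠ 0 →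
        (EuclideanDomain.gcd f (X ^ n - 1)).natDegree ≤ k := by
  have : NeZero (n : K) := ⟨hn⟩
  obtain ⟨ζ, hζ⟩ := HasEnoughRootsOfUnity.exists_primitiveRoot K n
  set ψ := AddChar.zmodChar n hζ.pow_eq_one
  have hprim : ψ.IsPrimitive := AddChar.zmodChar_primitive_of_primitive_root n hζ
  have hψ : Function.Injective ψ := fun s t hst => ZMod.val_injective n
    (hζ.pow_inj (ZMod.val_lt s) (ZMod.val_lt t) (by simpa [ψ, AddChar.zmodChar_apply] using hst))
  have hroots : ∀ r : K, r ^ n = 1 → ∃ t, ψ t = r := by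
    intro r hr
    obtain ⟨i, hi, rfl⟩ := hζ.eq_pow_of_pow_eq_one hr
    exact ⟨i, by rw [AddChar.zmodChar_apply, ZMod.val_cast_of_lt hi]⟩
  constructor
  · intro h f hf hf0
    by_contra! hlt
    obtain ⟨z, hz, hfz⟩ := (lt_natDegree_gcd_iff hn hψ hroots hf0 k).1 hlt
    obtain ⟨b, hb, rfl⟩ := (mem_span_monomials_iff A f).1 hf
    simp_rw [eval_sum_monomials] at hfz
    obtain rfl := eq_zero_of_hTop_eq_zero hψ hk h hb hz hfz
    simp at hf0
  · intro h
    refine hTop_eq_zero_of_forall hn hprim A fun b hb z hz hbz => ?_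
    by_contra hb0
    refine (h _ ((mem_span_monomials_iff A _).2 ⟨b, hb, rfl⟩) (sum_monomials_ne_zero hb0)).not_gt
      ((lt_natDegree_gcd_iff hn hψ hroots (sum_monomials_ne_zero hb0) k).2 ⟨z, hz, fun j => ?_⟩)
    rw [eval_sum_monomials, hbz]

end Polynomials

end SumComplex

open Classical

/-- for `p` prime not dividing `n` and `|A| = k+1`, the sum complex `X_A`
satisfies `h_k(X_A; 𝔽_p) = 0` iff for every nonzero polynomial `f` in the span, over the
algebraic closure of `𝔽_p`, of the monomials `{x^a : a ∈ A}`, the degree of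
`gcd(f(x), x^n - 1)` is at most `k`. -/
theorem Fp_acyclic_iff_gcd (p : ℕ) [Fact p.Prime] (n k : ℕ) [NeZero n] (hk : 0 < k)
    (hcop : Nat.Coprime (k + 1) n) (hp : ¬ (p ∣ n)) (A : Finset (ZMod n))
    (hA : A.card = k + 1) :
    hTop n (ZMod p) k A = 0 ↔
      ∀ f ∈ Submodule.span (AlgebraicClosure (ZMod p))
          {g : Polynomial (AlgebraicClosure (ZMod p)) | ∃ a ∈ A, g = Polynomial.X ^ a.val},
        f ≠ 0 →
        (EuclideanDomain.gcd f (Polynomial.X ^ n - 1)).natDegree ≤ k := by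
  rw [SumComplex.hTop_eq_zero_iff_extension (AlgebraicClosure (ZMod p))]
  refine SumComplex.hTop_eq_zero_iff_gcd (fun h => hp ?_) hcop A
  exact (CharP.cast_eq_zero_iff (AlgebraicClosure (ZMod p)) p n).1 h
end
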